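/- Let μ_N = (√(2N+1) + √(2N−1))/2, let S_{N,2}(x, y) = Σ_{k=0}^{N−1} φ_k(x) φ_k(y) be the GUE two-point correlation kernel, let S_τ(s, t) = τ_N S_{N,2}(μ_N + τ_N s, μ_N + τ_N t) be its rescaling, and let S_A(s, t) = ∫₀^∞ Ai(s+z) Ai(t+z) dz be the Airy kernel. For every real s₀ there exist constants C > 0 and N₀ ∈ ℕ such that for all N ≥ N₀: (∫_{s₀}^∞ ∫_{s₀}^∞ (S_τ(s,t) − S_A(s,t))² ds dt)^{1/2} ≤ C N^{−2/3} e^{−s₀}. -/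

import Mathlib

open Real Filter MeasureTheory

/-- Physicists' Hermite polynomial `H_n(x) = (-1)^n e^{x²} (d^n/dx^n) e^{-x²}`. -/
noncomputable def physHermite (n : ℕ) (x : ℝ) : ℝ :=
  (-1 : ℝ) ^ n * Real.exp (x ^ 2) * iteratedDeriv n (fun t : ℝ => Real.exp (-t ^ 2)) x

/-- Normalizing constant `h_n = √π 2^n n!`. -/
noncomputable def hNorm (n : ℕ) : ℝ := Real.sqrt Real.pi * 2 ^ n * (n.factorial : ℝ)

/-- Oscillator wave function `φ_n(x) = h_n^{-1/2} e^{-x²/2} H_n(x)`. -/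
noncomputable def osc (n : ℕ) (x : ℝ) : ℝ :=
  hNorm n ^ (-(1 : ℝ) / 2) * Real.exp (-x ^ 2 / 2) * physHermite n x

/-- Airy function `Ai(x) = π⁻¹ lim_{R→∞} ∫₀^R cos(t³/3 + xt) dt`. -/
noncomputable def Ai (x : ℝ) : ℝ :=
  Real.pi⁻¹ *
    limUnder Filter.atTop (fun R : ℝ => ∫ t in (0 : ℝ)..R, Real.cos (t ^ 3 / 3 + x * t))

/-- Scaling constant `τ_N = 2^{-1/2} N^{-1/6}`. -/
noncomputable def tauN (N : ℕ) : ℝ := (2 : ℝ) ^ (-(1 : ℝ) / 2) * (N : ℝ) ^ (-(1 : ℝ) / 6)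

/-- `Δ_N = (√(2N+1) - √(2N-1))/τ_N`. -/
noncomputable def DeltaN (N : ℕ) : ℝ :=
  (Real.sqrt (2 * N + 1) - Real.sqrt (2 * N - 1)) / tauN N

/-- Unitary-case centering `μ_N = (√(2N+1) + √(2N-1))/2`. -/
noncomputable def muU (N : ℕ) : ℝ := (Real.sqrt (2 * N + 1) + Real.sqrt (2 * N - 1)) / 2

/-- GUE two-point correlation kernel `S_{N,2}(x,y) = Σ_{k<N} φ_k(x) φ_k(y)`. -/
noncomputable def SN2 (N : ℕ) (x y : ℝ) : ℝ := ∑ k ∈ Finset.range N, osc k x * osc k y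

/-- Airy kernel `S_A(s,t) = ∫₀^∞ Ai(s+z) Ai(t+z) dz`. -/
noncomputable def SAiry (s t : ℝ) : ℝ := ∫ z in Set.Ioi (0 : ℝ), Ai (s + z) * Ai (t + z)

section GaussianMoments

theorem one_add_abs_pow_le_exp_sq (m : ℕ) (v : ℝ) :
    (1 + |v|) ^ m ≤ m.factorial * Real.exp 2 * Real.exp (v ^ 2 / 4) := by
  have h1 := Real.pow_div_factorial_le_exp (1 + |v|) (by positivity) m
  have h2 : 1 + |v| ≤ 2 + v ^ 2 / 4 := by
    rw [← sq_abs v]; nlinarith [sq_nonneg (|v| - 2)]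
  have h3 : (0 : ℝ) < m.factorial := by positivity
  rw [div_le_iff₀ h3] at h1
  rw [mul_assoc, ← Real.exp_add]
  calc _ ≤ Real.exp (1 + |v|) * m.factorial := h1
    _ ≤ Real.exp (2 + v ^ 2 / 4) * m.factorial := by gcongr
    _ = _ := by ring

theorem integrable_one_add_abs_pow_mul_gaussian (m : ℕ) :
    Integrable (fun v : ℝ => (1 + |v|) ^ m * Real.exp (-v ^ 2 / 2)) := by
  have h := (integrable_exp_neg_mul_sq (b := 1 / 4) (by norm_num)).const_mul
    (m.factorial * Real.exp 2)
  refine h.mono' (by fun_prop) (Eventually.of_forall fun v => ?_)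
  rw [Real.norm_of_nonneg (by positivity)]
  calc (1 + |v|) ^ m * Real.exp (-v ^ 2 / 2)
      ≤ (m.factorial * Real.exp 2 * Real.exp (v ^ 2 / 4)) * Real.exp (-v ^ 2 / 2) := by
        gcongr; exact one_add_abs_pow_le_exp_sq m v
    _ = _ := by rw [mul_assoc _ (Real.exp _) (Real.exp _), ← Real.exp_add]; ring_nf

/-- The Gaussian moment `∫ (1 + |v|)^m e^{-v²/2} dv`. -/
noncomputable def gaussianMoment (m : ℕ) : ℝ := ∫ v : ℝ, (1 + |v|) ^ m * Real.exp (-v ^ 2 / 2)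

theorem gaussianMoment_nonneg (m : ℕ) : 0 ≤ gaussianMoment m :=
  integral_nonneg fun v => by positivity

theorem integrable_of_norm_le_gaussian {f : ℝ → ℂ} (hf : Continuous f) {K : ℝ} {m : ℕ}
    (h : ∀ v, ‖f v‖ ≤ K * ((1 + |v|) ^ m * Real.exp (-v ^ 2 / 2))) : Integrable f :=
  ((integrable_one_add_abs_pow_mul_gaussian m).const_mul K).mono' hf.aestronglyMeasurable
    (Eventually.of_forall h)

theorem norm_integral_le_gaussianMoment {f : ℝ → ℂ} {K : ℝ} {m : ℕ}
    (h : ∀ v, ‖f v‖ ≤ K * ((1 + |v|) ^ m * Real.exp (-v ^ 2 / 2))) :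
    ‖∫ v, f v‖ ≤ K * gaussianMoment m := by
  rw [gaussianMoment, ← integral_const_mul]
  exact norm_integral_le_of_norm_le ((integrable_one_add_abs_pow_mul_gaussian m).const_mul K)
    (Eventually.of_forall h)

end GaussianMoments

section ComplexEstimates

/-- The point `c + iv` on the vertical line with real part `c`. -/
noncomputable def vline (c v : ℝ) : ℂ := (c : ℂ) + v * Complex.I

@[simp] theorem vline_re (c v : ℝ) : (vline c v).re = c := by simp [vline]
@[simp] theorem vline_im (c v : ℝ) : (vline c v).im = v := by simp [vline]

@[fun_prop]
theorem continuous_vline (c : ℝ) : Continuous (vline c) := by unfold vline; fun_prop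

theorem hasDerivAt_vline (c v : ℝ) : HasDerivAt (vline c) Complex.I v := by
  have : HasDerivAt (fun v : ℝ => (v : ℂ) * Complex.I) Complex.I v := by
    simpa using (Complex.ofRealCLM.hasDerivAt (x := v)).mul_const Complex.I
  exact this.const_add (c : ℂ)

theorem norm_vline_le (c v : ℝ) : ‖vline c v‖ ≤ |c| + |v| := by
  simpa using Complex.norm_le_abs_re_add_abs_im (vline c v)

theorem one_le_norm_one_add {z : ℂ} (hz : 0 ≤ z.re) : 1 ≤ ‖1 + z‖ := by
  have := Complex.re_le_norm (1 + z)
  simp at this; linarith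

theorem one_add_ne_zero_of_re_nonneg {z : ℂ} (hz : 0 ≤ z.re) : 1 + z ≠ 0 := by
  intro h; have := one_le_norm_one_add hz; rw [h] at this; simp at this; linarith

theorem norm_log_one_add_sub_taylor_four_le {z : ℂ} (hz : 0 ≤ z.re) :
    ‖Complex.log (1 + z) - (z - z ^ 2 / 2 + z ^ 3 / 3 - z ^ 4 / 4)‖ ≤ ‖z‖ ^ 5 := by
  let f : ℝ → ℂ := fun t => Complex.log (1 + t * z) -
    (t * z - (t * z) ^ 2 / 2 + (t * z) ^ 3 / 3 - (t * z) ^ 4 / 4)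
  have hre : ∀ t : ℝ, 0 ≤ t → 0 ≤ ((t : ℂ) * z).re := fun t ht => by
    simpa using mul_nonneg ht hz
  have hd : ∀ t ∈ Set.Icc (0 : ℝ) 1,
      HasDerivWithinAt f (z * (t * z) ^ 4 / (1 + t * z)) (Set.Icc 0 1) t := by
    intro t ht
    have hne := one_add_ne_zero_of_re_nonneg (hre t ht.1)
    have h0 : HasDerivAt (fun t : ℝ => (t : ℂ) * z) z t := by
      simpa using (Complex.ofRealCLM.hasDerivAt (x := t)).mul_const z
    have hslit : 1 + (t : ℂ) * z ∈ Complex.slitPlane := by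
      left; have := hre t ht.1; simp only [Complex.add_re, Complex.one_re]; linarith
    have h1 := (h0.const_add 1).clog_real hslit
    have h2 := h1.sub (((h0.sub ((h0.pow 2).div_const 2)).add ((h0.pow 3).div_const 3)).sub
      ((h0.pow 4).div_const 4))
    refine (h2.congr_deriv ?_).hasDerivWithinAt
    rw [eq_div_iff hne, sub_mul, div_mul_cancel₀ _ hne]
    push_cast
    ring
  have := norm_image_sub_le_of_norm_deriv_le_segment_01' (f := f) (C := ‖z‖ ^ 5) hd (by
    intro t ht
    rw [norm_div, norm_mul, norm_pow, norm_mul]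
    have h1 := one_le_norm_one_add (hre t ht.1)
    have h2 : ‖(t : ℂ)‖ ≤ 1 := by
      rw [Complex.norm_real, Real.norm_of_nonneg ht.1]; exact ht.2.le
    calc _ ≤ ‖z‖ * (‖(t : ℂ)‖ * ‖z‖) ^ 4 := div_le_self (by positivity) h1
      _ ≤ ‖z‖ * (1 * ‖z‖) ^ 4 := by gcongr
      _ = _ := by ring)
  simpa [f] using this

theorem norm_log_one_add_sub_taylor_three_le {z : ℂ} (hz : 0 ≤ z.re) :
    ‖Complex.log (1 + z) - (z - z ^ 2 / 2 + z ^ 3 / 3)‖ ≤ ‖z‖ ^ 4 := by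
  let f : ℝ → ℂ := fun t => Complex.log (1 + t * z) -
    (t * z - (t * z) ^ 2 / 2 + (t * z) ^ 3 / 3)
  have hre : ∀ t : ℝ, 0 ≤ t → 0 ≤ ((t : ℂ) * z).re := fun t ht => by
    simpa using mul_nonneg ht hz
  have hd : ∀ t ∈ Set.Icc (0 : ℝ) 1,
      HasDerivWithinAt f (-(z * (t * z) ^ 3) / (1 + t * z)) (Set.Icc 0 1) t := by
    intro t ht
    have hne := one_add_ne_zero_of_re_nonneg (hre t ht.1)
    have h0 : HasDerivAt (fun t : ℝ => (t : ℂ) * z) z t := by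
      simpa using (Complex.ofRealCLM.hasDerivAt (x := t)).mul_const z
    have hslit : 1 + (t : ℂ) * z ∈ Complex.slitPlane := by
      left; have := hre t ht.1; simp only [Complex.add_re, Complex.one_re]; linarith
    have h1 := (h0.const_add 1).clog_real hslit
    have h2 := h1.sub ((h0.sub ((h0.pow 2).div_const 2)).add ((h0.pow 3).div_const 3))
    refine (h2.congr_deriv ?_).hasDerivWithinAt
    rw [eq_div_iff hne, sub_mul, div_mul_cancel₀ _ hne]
    push_cast
    ring
  have := norm_image_sub_le_of_norm_deriv_le_segment_01' (f := f) (C := ‖z‖ ^ 4) hd (by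
    intro t ht
    rw [norm_div, norm_neg, norm_mul, norm_pow, norm_mul]
    have h1 := one_le_norm_one_add (hre t ht.1)
    have h2 : ‖(t : ℂ)‖ ≤ 1 := by
      rw [Complex.norm_real, Real.norm_of_nonneg ht.1]; exact ht.2.le
    calc _ ≤ ‖z‖ * (‖(t : ℂ)‖ * ‖z‖) ^ 3 := div_le_self (by positivity) h1
      _ ≤ ‖z‖ * (1 * ‖z‖) ^ 3 := by gcongr
      _ = _ := by ring)
  simpa [f] using this

theorem norm_exp_segment_le {p q : ℂ} {M : ℝ} (hp : ‖Complex.exp p‖ ≤ M)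
    (hq : ‖Complex.exp q‖ ≤ M) {t : ℝ} (ht : t ∈ Set.Icc (0 : ℝ) 1) :
    ‖Complex.exp (q + t * (p - q))‖ ≤ M := by
  rw [Complex.norm_exp] at *
  have h : (q + t * (p - q)).re ≤ max p.re q.re := by
    simp only [Complex.add_re, Complex.re_ofReal_mul, Complex.sub_re]
    rcases le_total p.re q.re with h | h
    · rw [max_eq_right h]; nlinarith [ht.1]
    · rw [max_eq_left h]; nlinarith [ht.2]
  refine (Real.exp_le_exp.2 h).trans ?_
  rcases max_choice p.re q.re with h | h <;> rw [h] <;> assumption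

theorem norm_exp_sub_exp_le {p q : ℂ} {M : ℝ} (hp : ‖Complex.exp p‖ ≤ M)
    (hq : ‖Complex.exp q‖ ≤ M) : ‖Complex.exp p - Complex.exp q‖ ≤ ‖p - q‖ * M := by
  have hd : ∀ t ∈ Set.Icc (0 : ℝ) 1, HasDerivWithinAt
      (fun t : ℝ => Complex.exp (q + t * (p - q)))
      (Complex.exp (q + t * (p - q)) * (p - q)) (Set.Icc 0 1) t := fun t _ => by
    have h0 : HasDerivAt (fun t : ℝ => q + (t : ℂ) * (p - q)) (p - q) t := by
      simpa using ((Complex.ofRealCLM.hasDerivAt (x := t)).mul_const (p - q)).const_add q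
    exact h0.cexp.hasDerivWithinAt
  have := norm_image_sub_le_of_norm_deriv_le_segment_01' hd (C := ‖p - q‖ * M) (by
    intro t ht
    rw [norm_mul, mul_comm]
    gcongr
    exact norm_exp_segment_le hp hq ⟨ht.1, ht.2.le⟩)
  simpa using this

theorem norm_exp_sub_exp_sub_mul_le {p q : ℂ} {M : ℝ} (hp : ‖Complex.exp p‖ ≤ M)
    (hq : ‖Complex.exp q‖ ≤ M) :
    ‖Complex.exp p - Complex.exp q - Complex.exp q * (p - q)‖ ≤ ‖p - q‖ ^ 2 * M := by
  have hd : ∀ t ∈ Set.Icc (0 : ℝ) 1, HasDerivWithinAt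
      (fun t : ℝ => Complex.exp (q + t * (p - q)) - Complex.exp q * (t * (p - q)))
      (Complex.exp (q + t * (p - q)) * (p - q) - Complex.exp q * (p - q)) (Set.Icc 0 1) t :=
    fun t _ => by
    have h1 : HasDerivAt (fun t : ℝ => (t : ℂ) * (p - q)) (p - q) t := by
      simpa using (Complex.ofRealCLM.hasDerivAt (x := t)).mul_const (p - q)
    exact ((h1.const_add q).cexp.sub (h1.const_mul (Complex.exp q))).hasDerivWithinAt
  have hM : 0 ≤ M := (norm_nonneg _).trans hp
  have := norm_image_sub_le_of_norm_deriv_le_segment_01' hd (C := ‖p - q‖ ^ 2 * M) (by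
    intro t ht
    have ht' : t ∈ Set.Icc (0 : ℝ) 1 := ⟨ht.1, ht.2.le⟩
    rw [← sub_mul, norm_mul, sq, mul_right_comm]
    gcongr
    refine (norm_exp_sub_exp_le (norm_exp_segment_le hp hq ht') hq).trans ?_
    gcongr
    rw [add_sub_cancel_left, norm_mul, Complex.norm_real, Real.norm_of_nonneg ht.1]
    exact mul_le_of_le_one_left (norm_nonneg _) ht.2.le)
  simp only [Complex.ofReal_one, one_mul, Complex.ofReal_zero, zero_mul, add_zero, mul_zero,
    sub_zero, add_sub_cancel] at this
  rwa [sub_right_comm]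

end ComplexEstimates

section EdgeIntegrand

/-- The phase factor `((1 + z) e^{-z + z²/2})^N` of the Hermite saddle-point integral. -/
noncomputable def hermitePhase (N : ℕ) (z : ℂ) : ℂ :=
  ((1 + z) * Complex.exp (-z + z ^ 2 / 2)) ^ N

@[fun_prop]
theorem continuous_hermitePhase (N : ℕ) : Continuous (hermitePhase N) := by
  unfold hermitePhase; fun_prop

theorem norm_one_add_mul_exp_le {h : ℝ} (h0 : 0 < h) (h1 : h ≤ 1 / 2) {z : ℂ} (hz : h ≤ z.re) :
    ‖(1 + z) * Complex.exp (-z + z ^ 2 / 2)‖ ≤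
      (1 + z.re) * Real.exp (-z.re + z.re ^ 2 / 2) * Real.exp (-(h * z.im ^ 2) / 2) := by
  have hk : 0 < 1 + z.re := by linarith
  have e1 : ‖1 + z‖ ≤ (1 + z.re) * Real.exp (z.im ^ 2 / (2 * (1 + z.re) ^ 2)) := by
    refine abs_le_of_sq_le_sq' ?_ (by positivity) |>.2
    rw [mul_pow, ← Real.exp_nat_mul, Complex.sq_norm, Complex.normSq_apply]
    simp only [Complex.add_re, Complex.one_re, Complex.add_im, Complex.one_im, zero_add]
    have := Real.add_one_le_exp (((2 : ℕ) : ℝ) * (z.im ^ 2 / (2 * (1 + z.re) ^ 2)))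
    calc _ = (1 + z.re) ^ 2 * (((2 : ℕ) : ℝ) * (z.im ^ 2 / (2 * (1 + z.re) ^ 2)) + 1) := by
          push_cast; field_simp; ring
      _ ≤ _ := by gcongr
  rw [norm_mul, Complex.norm_exp]
  have hre : (-z + z ^ 2 / 2).re = -z.re + z.re ^ 2 / 2 - z.im ^ 2 / 2 := by
    have : (z ^ 2 / 2).re = (z ^ 2).re / 2 := by
      simp
    rw [Complex.add_re, Complex.neg_re, this, sq, Complex.mul_re]; ring
  rw [hre]
  have e2 : z.im ^ 2 / (2 * (1 + z.re) ^ 2) ≤ (1 - h) * z.im ^ 2 / 2 := by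
    rw [div_le_div_iff₀ (by positivity) (by norm_num)]
    have : 1 ≤ (1 - h) * (1 + z.re) ^ 2 := by
      have : (1 + h) ^ 2 ≤ (1 + z.re) ^ 2 := by gcongr
      nlinarith
    nlinarith [sq_nonneg z.im]
  calc _ ≤ ((1 + z.re) * Real.exp (z.im ^ 2 / (2 * (1 + z.re) ^ 2))) *
        Real.exp (-z.re + z.re ^ 2 / 2 - z.im ^ 2 / 2) := by gcongr
    _ ≤ ((1 + z.re) * Real.exp ((1 - h) * z.im ^ 2 / 2)) *
        Real.exp (-z.re + z.re ^ 2 / 2 - z.im ^ 2 / 2) := by gcongr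
    _ = _ := by
        rw [mul_assoc, mul_assoc, ← Real.exp_add, ← Real.exp_add]; ring_nf

variable {N : ℕ} {h : ℝ}

theorem norm_hermitePhase_le (h0 : 0 < h) (h1 : h ≤ 1 / 2) (hN : (N : ℝ) * h ^ 3 = 1)
    {c : ℝ} (hc : 1 ≤ c) (v : ℝ) :
    ‖hermitePhase N (h * vline c v)‖ ≤
      ((1 + h * c) * Real.exp (-(h * c) + (h * c) ^ 2 / 2)) ^ N * Real.exp (-v ^ 2 / 2) := by
  have hz : h ≤ ((h : ℂ) * vline c v).re := by
    rw [Complex.re_ofReal_mul, vline_re]; nlinarith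
  have := norm_one_add_mul_exp_le h0 h1 hz
  rw [Complex.re_ofReal_mul, Complex.im_ofReal_mul, vline_re, vline_im] at this
  rw [hermitePhase, norm_pow]
  refine (pow_le_pow_left₀ (norm_nonneg _) this N).trans (le_of_eq ?_)
  rw [mul_pow, ← Real.exp_nat_mul (-(h * (h * v) ^ 2) / 2)]
  congr 2
  linear_combination (-v ^ 2 / 2) * hN

theorem one_add_mul_exp_pow_le (h0 : 0 < h) (hN : (N : ℝ) * h ^ 3 = 1) :
    ((1 + h * 1) * Real.exp (-(h * 1) + (h * 1) ^ 2 / 2)) ^ N ≤ Real.exp (1 / 3) := by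
  have key : 1 + h ≤ Real.exp (h - h ^ 2 / 2 + h ^ 3 / 3) := by
    let f : ℝ → ℝ := fun x => x - x ^ 2 / 2 + x ^ 3 / 3 - Real.log (1 + x)
    have hd : ∀ x ∈ Set.Ici (0 : ℝ), HasDerivAt f (x ^ 3 / (1 + x)) x := by
      intro x hx
      have hx' : 1 + x ≠ 0 := by have : (0 : ℝ) ≤ x := hx; linarith
      have h1 := (((hasDerivAt_id x).sub (((hasDerivAt_id x).pow 2).div_const 2)).add
        (((hasDerivAt_id x).pow 3).div_const 3)).sub (((hasDerivAt_id x).const_add 1).log hx')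
      refine h1.congr_deriv ?_
      simp only [id]
      field_simp
      push_cast
      ring
    have hm : MonotoneOn f (Set.Ici 0) := by
      apply monotoneOn_of_deriv_nonneg (convex_Ici 0)
      · exact fun x hx => (hd x hx).continuousAt.continuousWithinAt
      · exact fun x hx => (hd x (interior_subset hx)).differentiableAt.differentiableWithinAt
      · intro x hx
        have hx' := interior_subset hx
        rw [(hd x hx').deriv]
        have : (0 : ℝ) ≤ x := hx'
        positivity
    have := hm (Set.mem_Ici.2 le_rfl) (Set.mem_Ici.2 h0.le) h0.le
    simp only [f] at this
    norm_num at this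
    rwa [Real.log_le_iff_le_exp (by linarith)] at this
  have : (1 + h * 1) * Real.exp (-(h * 1) + (h * 1) ^ 2 / 2) ≤ Real.exp (h ^ 3 / 3) := by
    calc _ ≤ Real.exp (h - h ^ 2 / 2 + h ^ 3 / 3) * Real.exp (-(h * 1) + (h * 1) ^ 2 / 2) := by
          rw [mul_one]; gcongr
      _ = _ := by rw [← Real.exp_add]; ring_nf
  refine (pow_le_pow_left₀ (by positivity) this N).trans (le_of_eq ?_)
  rw [← Real.exp_nat_mul]
  congr 1
  linear_combination hN / 3

theorem exp_third_le_two : Real.exp (1 / 3) ≤ 2 := by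
  have h1 : Real.exp (1 / 3) ≤ Real.exp (Real.log 2) := by
    apply Real.exp_le_exp.2; linarith [Real.log_two_gt_d9]
  rwa [Real.exp_log (by norm_num)] at h1

theorem norm_hermitePhase_one_le (h0 : 0 < h) (h1 : h ≤ 1 / 2) (hN : (N : ℝ) * h ^ 3 = 1)
    (v : ℝ) : ‖hermitePhase N (h * vline 1 v)‖ ≤ 2 * Real.exp (-v ^ 2 / 2) := by
  refine (norm_hermitePhase_le h0 h1 hN le_rfl v).trans ?_
  gcongr
  exact (one_add_mul_exp_pow_le h0 hN).trans exp_third_le_two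

theorem norm_exp_cube_le (v : ℝ) :
    ‖Complex.exp (vline 1 v ^ 3 / 3)‖ ≤ 2 * Real.exp (-v ^ 2 / 2) := by
  rw [Complex.norm_exp]
  have : (vline 1 v ^ 3 / 3).re = 1 / 3 - v ^ 2 := by
    have e : vline 1 v ^ 3 / 3 = ((1 / 3 - v ^ 2 : ℝ) : ℂ) + ((v - v ^ 3 / 3 : ℝ) : ℂ) *
        Complex.I := by
      simp only [vline]; push_cast
      linear_combination ((v : ℂ) ^ 2 + (v : ℂ) ^ 3 * Complex.I / 3) * Complex.I_sq
    rw [e, Complex.add_re, Complex.ofReal_re, Complex.re_ofReal_mul, Complex.I_re]; ring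
  rw [this]
  calc Real.exp (1 / 3 - v ^ 2) ≤ Real.exp (1 / 3 + -v ^ 2 / 2) := by
        apply Real.exp_le_exp.2; nlinarith [sq_nonneg v]
    _ = Real.exp (1 / 3) * Real.exp (-v ^ 2 / 2) := Real.exp_add _ _
    _ ≤ _ := by gcongr; exact exp_third_le_two

/-- The amplitude attached to `φ_N + φ_{N-1}`. -/
noncomputable def sumAmplitude (z : ℂ) : ℂ := (1 + (1 + z)⁻¹) / 2

/-- The amplitude attached to `φ_N - φ_{N-1}`. -/
noncomputable def diffAmplitude (z : ℂ) : ℂ := (1 - (1 + z)⁻¹) / 2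

theorem norm_inv_one_add_le {z : ℂ} (hz : 0 ≤ z.re) : ‖(1 + z)⁻¹‖ ≤ 1 := by
  rw [norm_inv]; exact inv_le_one_of_one_le₀ (one_le_norm_one_add hz)

theorem norm_sumAmplitude_le {z : ℂ} (hz : 0 ≤ z.re) : ‖sumAmplitude z‖ ≤ 1 := by
  rw [sumAmplitude, norm_div]
  have := norm_add_le 1 (1 + z)⁻¹
  have := norm_inv_one_add_le hz
  simp at *; linarith

theorem norm_diffAmplitude_le_one {z : ℂ} (hz : 0 ≤ z.re) : ‖diffAmplitude z‖ ≤ 1 := by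
  rw [diffAmplitude, norm_div]
  have := norm_sub_le 1 (1 + z)⁻¹
  have := norm_inv_one_add_le hz
  simp at *; linarith

theorem norm_diffAmplitude_le {z : ℂ} (hz : 0 ≤ z.re) : ‖diffAmplitude z‖ ≤ ‖z‖ := by
  have hne := one_add_ne_zero_of_re_nonneg hz
  have : diffAmplitude z = z * (1 + z)⁻¹ / 2 := by
    rw [diffAmplitude]; field_simp; ring
  rw [this, norm_div, norm_mul]
  have := mul_le_mul_of_nonneg_left (norm_inv_one_add_le hz) (norm_nonneg z)
  simp at *; linarith [norm_nonneg z]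

theorem norm_sumAmplitude_sub_le {z : ℂ} (hz : 0 ≤ z.re) :
    ‖sumAmplitude z - 1 + z / 2‖ ≤ ‖z‖ ^ 2 := by
  have hne := one_add_ne_zero_of_re_nonneg hz
  have : sumAmplitude z - 1 + z / 2 = z ^ 2 * (1 + z)⁻¹ / 2 := by
    rw [sumAmplitude]; field_simp; ring
  rw [this, norm_div, norm_mul, norm_pow]
  have := mul_le_mul_of_nonneg_left (norm_inv_one_add_le hz) (sq_nonneg ‖z‖)
  simp at *; linarith [sq_nonneg ‖z‖]

theorem norm_one_sub_sumAmplitude_le {z : ℂ} (hz : 0 ≤ z.re) :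
    ‖1 - sumAmplitude z‖ ≤ ‖z‖ := by
  have : 1 - sumAmplitude z = diffAmplitude z := by simp only [sumAmplitude, diffAmplitude]; ring
  rw [this]; exact norm_diffAmplitude_le hz

theorem hermitePhase_eq_exp {z : ℂ} (hz : 0 ≤ z.re) :
    hermitePhase N z = Complex.exp (N * (Complex.log (1 + z) - z + z ^ 2 / 2)) := by
  rw [hermitePhase, Complex.exp_nat_mul]
  congr 1
  rw [sub_add, Complex.exp_sub, Complex.exp_log (one_add_ne_zero_of_re_nonneg hz),
    div_eq_mul_inv (1 + z), ← Complex.exp_neg]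
  congr 2; ring

theorem norm_sumAmplitude_mul_hermitePhase_sub_le (h0 : 0 < h) (h1 : h ≤ 1 / 2)
    (hN : (N : ℝ) * h ^ 3 = 1) (v : ℝ) :
    ‖sumAmplitude (h * vline 1 v) * hermitePhase N (h * vline 1 v) -
      Complex.exp (vline 1 v ^ 3 / 3) * (1 - h * (vline 1 v / 2 + vline 1 v ^ 4 / 4))‖ ≤
      h ^ 2 * (8 * ((1 + |v|) ^ 8 * Real.exp (-v ^ 2 / 2))) := by
  set w := vline 1 v with hw
  set z : ℂ := h * w with hz
  have hzre : 0 ≤ z.re := by rw [hz, Complex.re_ofReal_mul, vline_re]; linarith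
  have hzn : ‖z‖ = h * ‖w‖ := by rw [hz, norm_mul, Complex.norm_real, Real.norm_of_nonneg h0.le]
  have hwn : ‖w‖ ≤ 1 + |v| := by simpa using norm_vline_le 1 v
  have hNc : (N : ℂ) * (h : ℂ) ^ 3 = 1 := by exact_mod_cast hN
  set p : ℂ := N * (Complex.log (1 + z) - z + z ^ 2 / 2) with hp
  set q : ℂ := w ^ 3 / 3 with hq
  set E := Real.exp (-v ^ 2 / 2) with hE
  have hpM : ‖Complex.exp p‖ ≤ 2 * E := by
    rw [hp, ← hermitePhase_eq_exp hzre]; exact norm_hermitePhase_one_le h0 h1 hN v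
  have hqM : ‖Complex.exp q‖ ≤ 2 * E := norm_exp_cube_le v
  have hpq1 : ‖p - q‖ ≤ h * ‖w‖ ^ 4 := by
    have e : p - q = N * (Complex.log (1 + z) - (z - z ^ 2 / 2 + z ^ 3 / 3)) := by
      rw [hp, hq, hz]; linear_combination (w ^ 3 / 3) * hNc
    rw [e, norm_mul, Complex.norm_natCast]
    calc _ ≤ N * ‖z‖ ^ 4 := by gcongr; exact norm_log_one_add_sub_taylor_three_le hzre
      _ = _ := by rw [hzn]; linear_combination (h * ‖w‖ ^ 4) * hN
  have hpq2 : ‖p - q + h * w ^ 4 / 4‖ ≤ h ^ 2 * ‖w‖ ^ 5 := by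
    have e : p - q + h * w ^ 4 / 4 =
        N * (Complex.log (1 + z) - (z - z ^ 2 / 2 + z ^ 3 / 3 - z ^ 4 / 4)) := by
      rw [hp, hq, hz]; linear_combination (w ^ 3 / 3 - h * w ^ 4 / 4) * hNc
    rw [e, norm_mul, Complex.norm_natCast]
    calc _ ≤ N * ‖z‖ ^ 5 := by gcongr; exact norm_log_one_add_sub_taylor_four_le hzre
      _ = _ := by rw [hzn]; linear_combination (h ^ 2 * ‖w‖ ^ 5) * hN
  have hr1 := norm_sumAmplitude_le hzre
  have hr2 := norm_sumAmplitude_sub_le hzre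
  have hr3 := norm_one_sub_sumAmplitude_le hzre
  set r := sumAmplitude z with hr
  rw [hermitePhase_eq_exp hzre, ← hp]
  have e : r * Complex.exp p - Complex.exp q * (1 - h * (w / 2 + w ^ 4 / 4)) =
      r * (Complex.exp p - Complex.exp q - Complex.exp q * (p - q)) +
      Complex.exp q * ((r - 1 + z / 2) + r * (p - q + h * w ^ 4 / 4) +
        (1 - r) * (h * w ^ 4 / 4)) := by rw [hz]; ring
  rw [e]
  have n4 : ‖(h : ℂ) * w ^ 4 / 4‖ ≤ h * ‖w‖ ^ 4 := by
    rw [norm_div, norm_mul, norm_pow, Complex.norm_real, Real.norm_of_nonneg h0.le]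
    exact div_le_self (by positivity) (by norm_num)
  have hE0 : 0 < E := Real.exp_pos _
  have hA : 1 ≤ 1 + |v| := by linarith [abs_nonneg v]
  calc _ ≤ ‖r‖ * ‖Complex.exp p - Complex.exp q - Complex.exp q * (p - q)‖ +
        ‖Complex.exp q‖ * (‖r - 1 + z / 2‖ + ‖r‖ * ‖p - q + h * w ^ 4 / 4‖ +
          ‖1 - r‖ * ‖(h : ℂ) * w ^ 4 / 4‖) := by
        refine (norm_add_le _ _).trans ?_
        rw [norm_mul, norm_mul]
        gcongr
        refine (norm_add_le _ _).trans ?_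
        rw [norm_mul]
        gcongr
        refine (norm_add_le _ _).trans ?_
        rw [norm_mul]
    _ ≤ 1 * ((h * ‖w‖ ^ 4) ^ 2 * (2 * E)) +
        (2 * E) * ((h * ‖w‖) ^ 2 + 1 * (h ^ 2 * ‖w‖ ^ 5) + (h * ‖w‖) * (h * ‖w‖ ^ 4)) := by
        rw [hzn] at hr2 hr3
        gcongr
        exact (norm_exp_sub_exp_sub_mul_le hpM hqM).trans (by gcongr)
    _ = h ^ 2 * ((‖w‖ ^ 8 + ‖w‖ ^ 2 + 2 * ‖w‖ ^ 5) * (2 * E)) := by ring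
    _ ≤ h ^ 2 * (((1 + |v|) ^ 8 + (1 + |v|) ^ 8 + 2 * (1 + |v|) ^ 8) * (2 * E)) := by
        gcongr
        · exact (pow_le_pow_left₀ (norm_nonneg _) hwn 2).trans
            (pow_le_pow_right₀ hA (by norm_num))
        · exact (pow_le_pow_left₀ (norm_nonneg _) hwn 5).trans
            (pow_le_pow_right₀ hA (by norm_num))
    _ = _ := by ring

end EdgeIntegrand

section AiryLine

theorem norm_exp_neg_mul_vline (s c v : ℝ) :
    ‖Complex.exp (-(s * vline c v))‖ = Real.exp (-(s * c)) := by
  rw [Complex.norm_exp, Complex.neg_re, Complex.re_ofReal_mul, vline_re]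

/-- The absolutely convergent Airy contour integral on the line `Re w = 1`. -/
noncomputable def airyLine (s : ℝ) : ℂ :=
  ∫ v : ℝ, Complex.exp (vline 1 v ^ 3 / 3) * Complex.exp (-(s * vline 1 v))

theorem norm_airy_integrand_mul_pow_le (s : ℝ) (k : ℕ) (v : ℝ) :
    ‖Complex.exp (vline 1 v ^ 3 / 3) * Complex.exp (-(s * vline 1 v)) * vline 1 v ^ k‖ ≤
      2 * Real.exp (-s) * ((1 + |v|) ^ k * Real.exp (-v ^ 2 / 2)) := by
  rw [norm_mul, norm_mul, norm_pow, norm_exp_neg_mul_vline]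
  calc _ ≤ (2 * Real.exp (-v ^ 2 / 2)) * Real.exp (-(s * 1)) * (1 + |v|) ^ k := by
        gcongr
        · exact norm_exp_cube_le v
        · simpa using norm_vline_le 1 v
    _ = _ := by rw [mul_one]; ring

theorem integrable_airy_integrand_mul_pow (s : ℝ) (k : ℕ) :
    Integrable fun v : ℝ =>
      Complex.exp (vline 1 v ^ 3 / 3) * Complex.exp (-(s * vline 1 v)) * vline 1 v ^ k :=
  integrable_of_norm_le_gaussian (by fun_prop) (norm_airy_integrand_mul_pow_le s k)

theorem integrable_airy_integrand (s : ℝ) : Integrable fun v : ℝ =>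
    Complex.exp (vline 1 v ^ 3 / 3) * Complex.exp (-(s * vline 1 v)) := by
  simpa using integrable_airy_integrand_mul_pow s 0

theorem norm_airyLine_le (s : ℝ) : ‖airyLine s‖ ≤ 2 * gaussianMoment 0 * Real.exp (-s) := by
  have := norm_integral_le_gaussianMoment (norm_airy_integrand_mul_pow_le s 0)
  simp only [pow_zero, mul_one] at this
  rw [airyLine]; linarith

/-- Integration by parts: `∫ e^{w³/3 - sw} (w⁴ + 2w) = s² ∫ e^{w³/3 - sw}`. -/
theorem integral_airy_integrand_mul_quartic (s : ℝ) :
    ∫ v : ℝ, Complex.exp (vline 1 v ^ 3 / 3) * Complex.exp (-(s * vline 1 v)) *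
      (vline 1 v / 2 + vline 1 v ^ 4 / 4) = s ^ 2 / 4 * airyLine s := by
  set G : ℝ → ℂ := fun v => Complex.exp (vline 1 v ^ 3 / 3) * Complex.exp (-(s * vline 1 v))
    with hG
  have i0 : Integrable G := integrable_airy_integrand s
  have ik : ∀ k : ℕ, Integrable fun v => G v * vline 1 v ^ k :=
    integrable_airy_integrand_mul_pow s
  have i1 : Integrable fun v => G v * vline 1 v := by simpa using ik 1
  have hd : ∀ v : ℝ, HasDerivAt (fun v => G v * (vline 1 v ^ 2 + s))
      (Complex.I * (G v * vline 1 v ^ 4 + 2 * (G v * vline 1 v) - s ^ 2 * G v)) v := by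
    intro v
    have h0 := hasDerivAt_vline 1 v
    have h1 := ((h0.pow 3).div_const 3).cexp.mul ((h0.const_mul (s : ℂ)).neg.cexp)
    have h2 := h1.mul ((h0.pow 2).add_const (s : ℂ))
    refine h2.congr_deriv ?_
    simp only [hG, Pi.pow_apply, Pi.mul_apply, Pi.neg_apply]
    push_cast
    ring
  have iF : Integrable (fun v => G v * (vline 1 v ^ 2 + s)) := by
    have := (ik 2).add (i0.mul_const (s : ℂ))
    refine this.congr (Eventually.of_forall fun v => ?_)
    simp only [Pi.add_apply]; ring
  have i4 : Integrable (fun v => G v * vline 1 v ^ 4 + 2 * (G v * vline 1 v)) :=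
    (ik 4).add (i1.const_mul 2)
  have iF' : Integrable (fun v => G v * vline 1 v ^ 4 + 2 * (G v * vline 1 v) - s ^ 2 * G v) :=
    i4.sub (i0.const_mul _)
  have h0 := integral_eq_zero_of_hasDerivAt_of_integrable hd (iF'.const_mul _) iF
  rw [integral_const_mul, mul_eq_zero, or_iff_right Complex.I_ne_zero,
    integral_sub i4 (i0.const_mul _), integral_const_mul] at h0
  have : ∀ v, G v * (vline 1 v / 2 + vline 1 v ^ 4 / 4) =
      (G v * vline 1 v ^ 4 + 2 * (G v * vline 1 v)) / 4 := fun v => by ring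
  change ∫ v, G v * (vline 1 v / 2 + vline 1 v ^ 4 / 4) = s ^ 2 / 4 * ∫ v, G v
  simp_rw [this, integral_div]
  rw [sub_eq_zero.1 h0]
  ring

theorem norm_airyLine_add_sub_le (s : ℝ) {δ : ℝ} (hδ : |δ| ≤ 1) :
    ‖airyLine (s + δ) - airyLine s‖ ≤ |δ| * (6 * gaussianMoment 1 * Real.exp (-s)) := by
  rw [airyLine, airyLine, ← integral_sub (integrable_airy_integrand _) (integrable_airy_integrand _)]
  have hb : ∀ v : ℝ, ‖Complex.exp (vline 1 v ^ 3 / 3) * Complex.exp (-((s + δ : ℝ) * vline 1 v)) -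
      Complex.exp (vline 1 v ^ 3 / 3) * Complex.exp (-(s * vline 1 v))‖ ≤
      (|δ| * (6 * Real.exp (-s))) * ((1 + |v|) ^ 1 * Real.exp (-v ^ 2 / 2)) := by
    intro v
    have e : Complex.exp (-((s + δ : ℝ) * vline 1 v)) =
        Complex.exp (-(s * vline 1 v)) * Complex.exp (-(δ * vline 1 v)) := by
      rw [← Complex.exp_add]; push_cast; ring_nf
    rw [e, ← mul_assoc, ← mul_sub_one, norm_mul, norm_mul, norm_exp_neg_mul_vline]
    have h3 : ‖Complex.exp (-(δ * vline 1 v)) - 1‖ ≤ |δ| * (1 + |v|) * 3 := by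
      have := norm_exp_sub_exp_le (p := -(δ * vline 1 v)) (q := 0) (M := 3)
        (by
          rw [norm_exp_neg_mul_vline]
          calc _ ≤ Real.exp 1 := Real.exp_le_exp.2 (by linarith [neg_abs_le δ])
            _ ≤ 3 := by linarith [Real.exp_one_lt_d9])
        (by norm_num)
      rw [Complex.exp_zero, sub_zero, norm_neg, norm_mul, Complex.norm_real, Real.norm_eq_abs]
        at this
      refine this.trans ?_
      gcongr
      simpa using norm_vline_le 1 v
    calc _ ≤ (2 * Real.exp (-v ^ 2 / 2)) * Real.exp (-(s * 1)) * (|δ| * (1 + |v|) * 3) := by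
          gcongr
          exact norm_exp_cube_le v
      _ = _ := by rw [mul_one, pow_one]; ring
  refine (norm_integral_le_gaussianMoment hb).trans (le_of_eq ?_)
  ring

theorem tendsto_integral_cos_airy (s : ℝ) :
    Tendsto (fun R : ℝ => ((2 * ∫ t in (0 : ℝ)..R, Real.cos (t ^ 3 / 3 + s * t) : ℝ) : ℂ))
      atTop (nhds (airyLine s)) := by
  set f : ℂ → ℂ := fun z => Complex.exp (z ^ 3 / 3) * Complex.exp (-(s * z)) with hf
  have hfd : Differentiable ℂ f := by unfold f; fun_prop
  have hfc : Continuous f := hfd.continuous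
  -- the contour integral along the imaginary axis
  have hcos : ∀ R : ℝ, ((2 * ∫ t in (0 : ℝ)..R, Real.cos (t ^ 3 / 3 + s * t) : ℝ) : ℂ) =
      ∫ y in (-R)..R, f (y * Complex.I) := by
    intro R
    have hc : Continuous fun y : ℝ => f (y * Complex.I) := by fun_prop
    have hI : ∀ a b : ℝ, IntervalIntegrable (fun y : ℝ => f (y * Complex.I)) volume a b :=
      fun a b => hc.intervalIntegrable a b
    have hc' : Continuous fun y : ℝ => f ((-y : ℝ) * Complex.I) := by fun_prop
    rw [← intervalIntegral.integral_add_adjacent_intervals (hI (-R) 0) (hI 0 R)]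
    have hneg := intervalIntegral.integral_comp_neg (a := 0) (b := R)
      (fun y : ℝ => f (y * Complex.I))
    rw [neg_zero] at hneg
    rw [← hneg, ← intervalIntegral.integral_add (hc'.intervalIntegrable _ _) (hI 0 R),
      ← intervalIntegral.integral_const_mul, ← intervalIntegral.integral_ofReal]
    refine intervalIntegral.integral_congr fun y _ => ?_
    simp only [hf]
    rw [← Complex.exp_add, ← Complex.exp_add]
    push_cast
    rw [Complex.two_cos]
    congr 2
    · linear_combination ((y : ℂ) ^ 3 * Complex.I / 3) * Complex.I_sq
    · linear_combination (-(y : ℂ) ^ 3 * Complex.I / 3) * Complex.I_sq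
  have hline : Tendsto (fun R : ℝ => ∫ y in (-R)..R, f (vline 1 y)) atTop (nhds (airyLine s)) :=
    intervalIntegral_tendsto_integral (integrable_airy_integrand s) tendsto_neg_atTop_atBot
      tendsto_id
  have hhor : ∀ ε : ℝ, ε ^ 2 = 1 →
      Tendsto (fun R : ℝ => ∫ x in (0 : ℝ)..1, f (vline x (ε * R))) atTop (nhds 0) := by
    intro ε hε
    have hnorm : ∀ x R : ℝ, ‖f (vline x (ε * R))‖ =
        Real.exp (x ^ 3 / 3 - s * x) * Real.exp (-(x * R ^ 2)) := by
      intro x R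
      simp only [hf]
      rw [norm_mul, norm_exp_neg_mul_vline, Complex.norm_exp, ← Real.exp_add, ← Real.exp_add]
      congr 1
      have e : vline x (ε * R) ^ 3 / 3 = ((x ^ 3 / 3 - x * R ^ 2 : ℝ) : ℂ) +
          ((x ^ 2 * (ε * R) - (ε * R) ^ 3 / 3 : ℝ) : ℂ) * Complex.I := by
        have hεc : (ε : ℂ) ^ 2 = 1 := by exact_mod_cast hε
        simp only [vline]; push_cast
        linear_combination ((x : ℂ) * (ε * R) ^ 2 + (ε * R : ℂ) ^ 3 * Complex.I / 3) *
          Complex.I_sq - (x : ℂ) * R ^ 2 * hεc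
      rw [e, Complex.add_re, Complex.ofReal_re, Complex.re_ofReal_mul, Complex.I_re]; ring
    have h0 : (0 : ℂ) = ∫ x in (0 : ℝ)..1, (0 : ℂ) := by simp
    rw [h0]
    refine intervalIntegral.tendsto_integral_filter_of_dominated_convergence
      (fun x => Real.exp (x ^ 3 / 3 - s * x)) ?_ ?_ ?_ ?_
    · refine Eventually.of_forall fun R => Continuous.aestronglyMeasurable ?_
      unfold vline; fun_prop
    · refine Eventually.of_forall fun R => Eventually.of_forall fun x hx => ?_
      rw [Set.uIoc_of_le zero_le_one] at hx
      rw [hnorm]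
      refine mul_le_of_le_one_right (Real.exp_pos _).le (Real.exp_le_one_iff.2 ?_)
      have := mul_nonneg hx.1.le (sq_nonneg R)
      linarith
    · exact Continuous.intervalIntegrable (by fun_prop) _ _
    · refine Eventually.of_forall fun x hx => ?_
      rw [Set.uIoc_of_le zero_le_one] at hx
      rw [tendsto_zero_iff_norm_tendsto_zero]
      simp_rw [hnorm]
      have : Tendsto (fun R : ℝ => Real.exp (-(x * R ^ 2))) atTop (nhds 0) :=
        Real.tendsto_exp_neg_atTop_nhds_zero.comp
          ((tendsto_pow_atTop two_ne_zero).const_mul_atTop hx.1)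
      simpa using this.const_mul (Real.exp (x ^ 3 / 3 - s * x))
  have hrect : ∀ R : ℝ, ∫ y in (-R)..R, f (y * Complex.I) =
      (∫ y in (-R)..R, f (vline 1 y)) - Complex.I * ((∫ x in (0 : ℝ)..1, f (vline x (-1 * R))) -
        ∫ x in (0 : ℝ)..1, f (vline x (1 * R))) := by
    intro R
    have := Complex.integral_boundary_rect_eq_zero_of_differentiableOn f (vline 0 (-R))
      (vline 1 R) hfd.differentiableOn
    simp only [vline_re, vline_im, smul_eq_mul] at this
    simp only [vline] at this ⊢
    simp only [Complex.ofReal_one, Complex.ofReal_zero, zero_add, neg_one_mul, one_mul] at this ⊢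
    linear_combination Complex.I * this + ((∫ y in (-R)..R, f (y * Complex.I)) -
      ∫ y in (-R)..R, f (1 + y * Complex.I)) * Complex.I_sq
  simp_rw [hcos, hrect]
  simpa using hline.sub (((hhor (-1) (by norm_num)).sub (hhor 1 (by norm_num))).const_mul
    Complex.I)

theorem airyLine_eq (s : ℝ) : airyLine s = ((2 * π * Ai s : ℝ) : ℂ) := by
  have h := tendsto_integral_cos_airy s
  have hre := (Complex.continuous_re.tendsto _).comp h
  have h2 := (Complex.continuous_ofReal.tendsto _).comp hre
  have h3 : airyLine s = ((airyLine s).re : ℂ) :=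
    tendsto_nhds_unique h (h2.congr fun R => by simp)
  have h4 : Tendsto (fun R : ℝ => ∫ t in (0 : ℝ)..R, Real.cos (t ^ 3 / 3 + s * t)) atTop
      (nhds ((airyLine s).re / 2)) :=
    (hre.div_const 2).congr fun R => by simp
  rw [h3, Ai, h4.limUnder_eq]
  congr 1
  field_simp

end AiryLine

section EdgeIntegral

/-- The rescaled saddle-point integral with amplitude `a` along the line `Re w = c`. -/
noncomputable def edgeIntegral (a : ℂ → ℂ) (N : ℕ) (h c s : ℝ) : ℂ :=
  ∫ v : ℝ, a (h * vline c v) * hermitePhase N (h * vline c v) * Complex.exp (-(s * vline c v))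

variable {N : ℕ} {h : ℝ}

theorem mul_vline_re_nonneg (h0 : 0 < h) {c : ℝ} (hc : 0 ≤ c) (v : ℝ) :
    0 ≤ ((h : ℂ) * vline c v).re := by
  rw [Complex.re_ofReal_mul, vline_re]; positivity

theorem continuous_inv_one_add_mul_vline (h0 : 0 < h) {c : ℝ} (hc : 0 ≤ c) :
    Continuous fun v : ℝ => (1 + (h : ℂ) * vline c v)⁻¹ :=
  Continuous.inv₀ (by fun_prop) fun v =>
    one_add_ne_zero_of_re_nonneg (mul_vline_re_nonneg h0 hc v)

theorem continuous_sumAmplitude_mul_vline (h0 : 0 < h) {c : ℝ} (hc : 0 ≤ c) :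
    Continuous fun v : ℝ => sumAmplitude (h * vline c v) :=
  (continuous_const.add (continuous_inv_one_add_mul_vline h0 hc)).div_const 2

theorem norm_edgeIntegral_sum_sub_le (h0 : 0 < h) (h1 : h ≤ 1 / 2) (hN : (N : ℝ) * h ^ 3 = 1)
    (s : ℝ) :
    ‖edgeIntegral sumAmplitude N h 1 s - (1 - h * s ^ 2 / 4 : ℝ) * airyLine s‖ ≤
      h ^ 2 * (8 * gaussianMoment 8 * Real.exp (-s)) := by
  set G : ℝ → ℂ := fun v => Complex.exp (vline 1 v ^ 3 / 3) * Complex.exp (-(s * vline 1 v))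
    with hG
  set E : ℝ → ℂ := fun v => sumAmplitude (h * vline 1 v) * hermitePhase N (h * vline 1 v) *
    Complex.exp (-(s * vline 1 v)) with hE
  have hEc : Continuous E :=
    ((continuous_sumAmplitude_mul_vline h0 zero_le_one).mul (by fun_prop)).mul (by fun_prop)
  have iE : Integrable E := by
    refine integrable_of_norm_le_gaussian (K := 2 * Real.exp (-s)) (m := 0) hEc fun v => ?_
    simp only [hE]
    rw [norm_mul, norm_mul, norm_exp_neg_mul_vline]
    calc _ ≤ 1 * (2 * Real.exp (-v ^ 2 / 2)) * Real.exp (-(s * 1)) := by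
          gcongr
          · exact norm_sumAmplitude_le (mul_vline_re_nonneg h0 zero_le_one v)
          · exact norm_hermitePhase_one_le h0 h1 hN v
      _ = _ := by rw [mul_one, pow_zero]; ring
  have iG : Integrable G := integrable_airy_integrand s
  have iG2 : Integrable fun v => G v * (vline 1 v / 2 + vline 1 v ^ 4 / 4) := by
    have := ((integrable_airy_integrand_mul_pow s 1).div_const 2).add
      ((integrable_airy_integrand_mul_pow s 4).div_const 4)
    refine this.congr (Eventually.of_forall fun v => ?_)
    simp only [Pi.add_apply, hG]; ring
  have hL : (1 - h * s ^ 2 / 4 : ℝ) * airyLine s =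
      ∫ v, (G v - h * (G v * (vline 1 v / 2 + vline 1 v ^ 4 / 4))) := by
    rw [integral_sub iG (iG2.const_mul _), integral_const_mul]
    simp only [hG]
    rw [integral_airy_integrand_mul_quartic s]
    rw [← airyLine]
    push_cast; ring
  have iH : Integrable fun v => G v - h * (G v * (vline 1 v / 2 + vline 1 v ^ 4 / 4)) :=
    iG.sub (iG2.const_mul (h : ℂ))
  change ‖(∫ v, E v) - _‖ ≤ _
  rw [hL, ← integral_sub iE iH]
  refine (norm_integral_le_gaussianMoment (m := 8) (K := h ^ 2 * (8 * Real.exp (-s)))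
    fun v => ?_).trans (le_of_eq (by ring))
  have e : E v - (G v - h * (G v * (vline 1 v / 2 + vline 1 v ^ 4 / 4))) =
      (sumAmplitude (h * vline 1 v) * hermitePhase N (h * vline 1 v) -
      Complex.exp (vline 1 v ^ 3 / 3) * (1 - h * (vline 1 v / 2 + vline 1 v ^ 4 / 4))) *
      Complex.exp (-(s * vline 1 v)) := by simp only [hE, hG]; ring
  rw [e, norm_mul, norm_exp_neg_mul_vline, mul_one]
  calc _ ≤ _ := mul_le_mul_of_nonneg_right
        (norm_sumAmplitude_mul_hermitePhase_sub_le h0 h1 hN v) (Real.exp_pos _).le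
    _ = _ := by ring

theorem norm_edgeIntegral_diff_le (h0 : 0 < h) (h1 : h ≤ 1 / 2) (hN : (N : ℝ) * h ^ 3 = 1)
    (s : ℝ) :
    ‖edgeIntegral diffAmplitude N h 1 s‖ ≤ h * (2 * gaussianMoment 1 * Real.exp (-s)) := by
  refine (norm_integral_le_gaussianMoment (m := 1) (K := h * (2 * Real.exp (-s)))
    fun v => ?_).trans (le_of_eq (by ring))
  rw [norm_mul, norm_mul, norm_exp_neg_mul_vline]
  calc _ ≤ (h * (1 + |v|)) * (2 * Real.exp (-v ^ 2 / 2)) * Real.exp (-(s * 1)) := by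
        gcongr
        · refine (norm_diffAmplitude_le (mul_vline_re_nonneg h0 zero_le_one v)).trans ?_
          rw [norm_mul, Complex.norm_real, Real.norm_of_nonneg h0.le]
          gcongr
          simpa using norm_vline_le 1 v
        · exact norm_hermitePhase_one_le h0 h1 hN v
    _ = _ := by rw [mul_one]; ring

theorem norm_edgeIntegral_large_le {a : ℂ → ℂ} (ha : ∀ z : ℂ, 0 ≤ z.re → ‖a z‖ ≤ 1)
    (h0 : 0 < h) (h1 : h ≤ 1 / 2) (hN : (N : ℝ) * h ^ 3 = 1) {s : ℝ} (hs : 1 ≤ h * s) :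
    Real.exp (h * s ^ 2 / 4) * ‖edgeIntegral a N h (h * s) s‖ ≤
      gaussianMoment 0 * Real.exp (-(h * s ^ 2 / 4)) := by
  have hphase : ((1 + h * (h * s)) * Real.exp (-(h * (h * s)) + (h * (h * s)) ^ 2 / 2)) ^ N ≤
      Real.exp (h * s ^ 2 / 2) := by
    have : (1 + h * (h * s)) * Real.exp (-(h * (h * s)) + (h * (h * s)) ^ 2 / 2) ≤
        Real.exp ((h * (h * s)) ^ 2 / 2) := by
      calc _ ≤ Real.exp (h * (h * s)) * Real.exp (-(h * (h * s)) + (h * (h * s)) ^ 2 / 2) := by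
            gcongr; linarith [Real.add_one_le_exp (h * (h * s))]
        _ = _ := by rw [← Real.exp_add]; ring_nf
    refine (pow_le_pow_left₀ (by positivity) this N).trans (le_of_eq ?_)
    rw [← Real.exp_nat_mul]
    congr 1
    linear_combination (h * s ^ 2 / 2) * hN
  have := norm_integral_le_gaussianMoment (m := 0)
    (K := Real.exp (h * s ^ 2 / 2) * Real.exp (-(h * s ^ 2)))
    (f := fun v => a (h * vline (h * s) v) * hermitePhase N (h * vline (h * s) v) *
      Complex.exp (-(s * vline (h * s) v))) (fun v => by
        rw [norm_mul, norm_mul, norm_exp_neg_mul_vline]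
        calc _ ≤ 1 * (Real.exp (h * s ^ 2 / 2) * Real.exp (-v ^ 2 / 2)) *
              Real.exp (-(s * (h * s))) := by
              gcongr
              · exact ha _ (mul_vline_re_nonneg h0 (by linarith) v)
              · exact (norm_hermitePhase_le h0 h1 hN hs v).trans (by gcongr)
          _ = _ := by rw [show s * (h * s) = h * s ^ 2 by ring]; ring)
  calc _ ≤ Real.exp (h * s ^ 2 / 4) * (Real.exp (h * s ^ 2 / 2) * Real.exp (-(h * s ^ 2)) *
        gaussianMoment 0) := by gcongr; exact this
    _ = gaussianMoment 0 * (Real.exp (h * s ^ 2 / 4) * Real.exp (h * s ^ 2 / 2) *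
        Real.exp (-(h * s ^ 2))) := by ring
    _ = _ := by rw [← Real.exp_add, ← Real.exp_add]; ring_nf

/-- In the far regime `h s ≥ 1` an `e^{-s/4}` bound yields an `h² e^{-s/8}` bound. -/
theorem exp_neg_quarter_le_of_one_le_mul (h0 : 0 < h) {s : ℝ} (hs : 1 ≤ h * s) :
    Real.exp (-(s / 4)) ≤ 128 * h ^ 2 * Real.exp (-(s / 8)) := by
  have hs0 : 0 < s := pos_of_mul_pos_right (by linarith) h0.le
  have h2 := Real.pow_div_factorial_le_exp (s / 8) (by positivity) 2
  have h3 : 1 ≤ (h * s) ^ 2 := one_le_pow₀ hs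
  have h4 : 1 ≤ 128 * h ^ 2 * Real.exp (s / 8) := by
    norm_num [Nat.factorial] at h2
    nlinarith [sq_nonneg h]
  calc Real.exp (-(s / 4)) = 1 * (Real.exp (-(s / 8)) * Real.exp (-(s / 8))) := by
        rw [one_mul, ← Real.exp_add]; ring_nf
    _ ≤ (128 * h ^ 2 * Real.exp (s / 8)) * (Real.exp (-(s / 8)) * Real.exp (-(s / 8))) := by
        gcongr
    _ = 128 * h ^ 2 * Real.exp (-(s / 8)) * (Real.exp (s / 8) * Real.exp (-(s / 8))) := by ring
    _ = _ := by rw [← Real.exp_add]; simp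

theorem exp_mul_sq_quarter_le (h0 : 0 < h) (h1 : h ≤ 1 / 2) {S s : ℝ} (hS : 0 ≤ S) (hs : -S ≤ s)
    (hhs : h * s ≤ 1) :
    Real.exp (h * s ^ 2 / 4) ≤ Real.exp (S ^ 2 + S) * Real.exp (s / 4) := by
  rw [← Real.exp_add]
  apply Real.exp_le_exp.2
  rcases le_total 0 s with h | h
  · nlinarith [sq_nonneg S]
  · have : s ^ 2 ≤ S ^ 2 := by nlinarith
    nlinarith

theorem abs_exp_mul_one_sub_sub_one_le {y : ℝ} (hy : 0 ≤ y) :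
    |Real.exp y * (1 - y) - 1| ≤ y ^ 2 * Real.exp y := by
  have h1 := Real.add_one_le_exp (-y)
  have h2 : Real.exp (-y) ≤ 1 - y + y ^ 2 := by
    rcases le_total y 1 with h | h
    · have := Real.abs_exp_sub_one_sub_id_le (x := -y) (by rwa [abs_neg, abs_of_nonneg hy])
      have := (abs_le.1 this).2
      nlinarith
    · have : Real.exp (-y) ≤ 1 := Real.exp_le_one_iff.2 (by linarith)
      nlinarith
  have e : Real.exp y * (1 - y) - 1 = Real.exp y * ((1 - y) - Real.exp (-y)) := by
    rw [mul_sub (Real.exp y) (1 - y), ← Real.exp_add]; simp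
  rw [e, abs_mul, abs_of_pos (Real.exp_pos y), mul_comm]
  gcongr
  rw [abs_le]; constructor <;> nlinarith

theorem abs_Ai_le (s : ℝ) : |Ai s| ≤ 2 * gaussianMoment 0 * Real.exp (-s) := by
  have h := norm_airyLine_le s
  rw [airyLine_eq, Complex.norm_real, Real.norm_eq_abs, abs_mul,
    abs_of_pos (by positivity : (0 : ℝ) < 2 * π)] at h
  nlinarith [abs_nonneg (Ai s), Real.pi_gt_three]

theorem exp_neg_mul_le {S s a : ℝ} (hs : -S ≤ s) (hS : 0 ≤ S) (ha : 1 / 8 ≤ a) (ha' : a ≤ 1) :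
    Real.exp (-(a * s)) ≤ Real.exp S * Real.exp (-(s / 8)) := by
  rw [← Real.exp_add]
  apply Real.exp_le_exp.2
  nlinarith

/-- Uniform edge approximation: the sum-amplitude integral is `Ai` up to `O(h²)`. -/
theorem exists_norm_sub_Ai_le (S : ℝ) (hS : 0 ≤ S) : ∃ C ≥ 0, ∀ (N : ℕ) (h K : ℝ), 0 < h →
    h ≤ 1 / 2 → (N : ℝ) * h ^ 3 = 1 → 0 ≤ K → K ≤ 1 → |K - 1 / (2 * π)| ≤ h ^ 2 →
    ∀ s ≥ -S, ∀ F : ℝ, (∀ c ≥ 1, (F : ℂ) = (K * Real.exp (h * s ^ 2 / 4) : ℝ) *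
      edgeIntegral sumAmplitude N h c s) → |F - Ai s| ≤ C * h ^ 2 * Real.exp (-(s / 8)) := by
  set M0 := gaussianMoment 0
  set M8 := gaussianMoment 8
  have hM0 : 0 ≤ M0 := gaussianMoment_nonneg 0
  have hM8 : 0 ≤ M8 := gaussianMoment_nonneg 8
  set A := Real.exp (S ^ 2 + S) with hA
  set B := Real.exp S with hB
  refine ⟨8 * M8 * A * B + 48 * M0 * A * B * B + 2 * M0 * B + 384 * M0, by positivity, ?_⟩
  intro N h K h0 h1 hN hK0 hK1 hK s hs F hF
  rcases le_total 1 (h * s) with hhs | hhs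
  · have hs0 : 0 < s := pos_of_mul_pos_right (by linarith) h0.le
    have b1 : |F| ≤ M0 * Real.exp (-(s / 4)) := by
      have e := congrArg norm (hF (h * s) hhs)
      rw [Complex.norm_real, Real.norm_eq_abs, norm_mul, Complex.norm_real, Real.norm_eq_abs,
        abs_of_nonneg (by positivity : 0 ≤ K * Real.exp (h * s ^ 2 / 4))] at e
      rw [e, mul_assoc]
      calc _ ≤ 1 * (M0 * Real.exp (-(h * s ^ 2 / 4))) := by
            exact mul_le_mul hK1 (norm_edgeIntegral_large_le (a := sumAmplitude)
              (fun z hz => norm_sumAmplitude_le hz) h0 h1 hN hhs) (by positivity) zero_le_one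
        _ ≤ 1 * (M0 * Real.exp (-(s / 4))) := by gcongr; nlinarith
        _ = _ := one_mul _
    have b2 : |Ai s| ≤ 2 * M0 * Real.exp (-(s / 4)) :=
      (abs_Ai_le s).trans (by gcongr; linarith)
    have b3 := exp_neg_quarter_le_of_one_le_mul h0 hhs
    calc |F - Ai s| ≤ |F| + |Ai s| := abs_sub _ _
      _ ≤ 3 * M0 * Real.exp (-(s / 4)) := by linarith
      _ ≤ 3 * M0 * (128 * h ^ 2 * Real.exp (-(s / 8))) := by gcongr
      _ = (384 * M0) * h ^ 2 * Real.exp (-(s / 8)) := by ring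
      _ ≤ _ := by
        have : 0 ≤ 8 * M8 * A * B + 48 * M0 * A * B * B + 2 * M0 * B := by positivity
        exact mul_le_mul_of_nonneg_right (mul_le_mul_of_nonneg_right (by linarith) (sq_nonneg h))
          (Real.exp_pos _).le
  · set L := airyLine s with hL
    set y := h * s ^ 2 / 4 with hy
    have hy0 : 0 ≤ y := by positivity
    set J := edgeIntegral sumAmplitude N h 1 s with hJ
    have e : ((F - Ai s : ℝ) : ℂ) = (K * Real.exp y : ℝ) * (J - (1 - y : ℝ) * L) +
        (K * (Real.exp y * (1 - y) - 1) : ℝ) * L + (K - 1 / (2 * π) : ℝ) * L := by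
      have hAi : (Ai s : ℂ) = ((1 / (2 * π) : ℝ) : ℂ) * L := by
        rw [hL, airyLine_eq, ← Complex.ofReal_mul]; congr 1; field_simp
      rw [Complex.ofReal_sub, hF 1 le_rfl, hAi]
      push_cast; ring
    have hLn : ‖L‖ ≤ 2 * M0 * Real.exp (-s) := norm_airyLine_le s
    have hJn : ‖J - (1 - y : ℝ) * L‖ ≤ h ^ 2 * (8 * M8 * Real.exp (-s)) :=
      norm_edgeIntegral_sum_sub_le h0 h1 hN s
    have hey : Real.exp y ≤ A * Real.exp (s / 4) := exp_mul_sq_quarter_le h0 h1 hS hs hhs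
    have hs4 : y ^ 2 ≤ h ^ 2 * (24 * B * Real.exp (s / 2)) := by
      have h4 := Real.pow_div_factorial_le_exp ((s + 2 * S) / 2) (by linarith) 4
      have h5 : |s| ≤ s + 2 * S := abs_le.2 ⟨by linarith, by linarith⟩
      have h6 : s ^ 4 ≤ (s + 2 * S) ^ 4 := by
        have := pow_le_pow_left₀ (abs_nonneg s) h5 4
        rwa [Even.pow_abs (by decide)] at this
      have h7 : Real.exp ((s + 2 * S) / 2) = B * Real.exp (s / 2) := by
        rw [hB, ← Real.exp_add]; ring_nf
      rw [h7] at h4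
      norm_num [Nat.factorial, div_pow] at h4
      have : y ^ 2 = h ^ 2 * (s ^ 4 / 16) := by rw [hy]; ring
      rw [this]
      gcongr
      linarith
    have a1 := exp_neg_mul_le (a := 3 / 4) hs hS (by norm_num) (by norm_num)
    have a2 := exp_neg_mul_le (a := 1 / 4) hs hS (by norm_num) (by norm_num)
    have a3 := exp_neg_mul_le (a := 1) hs hS (by norm_num) (by norm_num)
    rw [one_mul] at a3
    have n := congrArg norm e
    rw [Complex.norm_real, Real.norm_eq_abs] at n
    rw [n]
    calc _ ≤ K * Real.exp y * ‖J - (1 - y : ℝ) * L‖ +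
          K * |Real.exp y * (1 - y) - 1| * ‖L‖ + |K - 1 / (2 * π)| * ‖L‖ := by
          refine (norm_add₃_le).trans (le_of_eq ?_)
          rw [norm_mul, norm_mul, norm_mul, Complex.norm_real, Complex.norm_real,
            Complex.norm_real, Real.norm_eq_abs, Real.norm_eq_abs, Real.norm_eq_abs,
            abs_of_nonneg (by positivity : 0 ≤ K * Real.exp y), abs_mul, abs_of_nonneg hK0]
      _ ≤ 1 * (A * Real.exp (s / 4)) * (h ^ 2 * (8 * M8 * Real.exp (-s))) +
          1 * ((h ^ 2 * (24 * B * Real.exp (s / 2))) * (A * Real.exp (s / 4))) *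
            (2 * M0 * Real.exp (-s)) + h ^ 2 * (2 * M0 * Real.exp (-s)) := by
          gcongr
          exact (abs_exp_mul_one_sub_sub_one_le hy0).trans (by gcongr)
      _ = h ^ 2 * (8 * M8 * A * (Real.exp (s / 4) * Real.exp (-s)) +
          48 * M0 * A * B * (Real.exp (s / 2) * Real.exp (s / 4) * Real.exp (-s)) +
          2 * M0 * Real.exp (-s)) := by ring
      _ = h ^ 2 * (8 * M8 * A * Real.exp (-(3 / 4 * s)) +
          48 * M0 * A * B * Real.exp (-(1 / 4 * s)) + 2 * M0 * Real.exp (-s)) := by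
          rw [← Real.exp_add, ← Real.exp_add, ← Real.exp_add]; ring_nf
      _ ≤ h ^ 2 * (8 * M8 * A * (B * Real.exp (-(s / 8))) +
          48 * M0 * A * B * (B * Real.exp (-(s / 8))) + 2 * M0 * (B * Real.exp (-(s / 8)))) := by
          gcongr
      _ = (8 * M8 * A * B + 48 * M0 * A * B * B + 2 * M0 * B) * h ^ 2 *
          Real.exp (-(s / 8)) := by ring
      _ ≤ _ := mul_le_mul_of_nonneg_right (mul_le_mul_of_nonneg_right (by linarith) (sq_nonneg h))
          (Real.exp_pos _).le

/-- Uniform edge bound: the difference-amplitude integral is `O(h)`. -/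
theorem exists_norm_diff_le (S : ℝ) (hS : 0 ≤ S) : ∃ C ≥ 0, ∀ (N : ℕ) (h K : ℝ), 0 < h →
    h ≤ 1 / 2 → (N : ℝ) * h ^ 3 = 1 → 0 ≤ K → K ≤ 1 →
    ∀ s ≥ -S, ∀ F : ℝ, (∀ c ≥ 1, (F : ℂ) = (K * Real.exp (h * s ^ 2 / 4) : ℝ) *
      edgeIntegral diffAmplitude N h c s) → |F| ≤ C * h * Real.exp (-(s / 8)) := by
  set M0 := gaussianMoment 0
  set M1 := gaussianMoment 1
  have hM0 : 0 ≤ M0 := gaussianMoment_nonneg 0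
  have hM1 : 0 ≤ M1 := gaussianMoment_nonneg 1
  set A := Real.exp (S ^ 2 + S) with hA
  set B := Real.exp S with hB
  refine ⟨2 * M1 * A * B + 128 * M0, by positivity, ?_⟩
  intro N h K h0 h1 hN hK0 hK1 s hs F hF
  have e : ∀ c ≥ 1, |F| = K * (Real.exp (h * s ^ 2 / 4) *
      ‖edgeIntegral diffAmplitude N h c s‖) := by
    intro c hc
    have e := congrArg norm (hF c hc)
    rw [Complex.norm_real, Real.norm_eq_abs, norm_mul, Complex.norm_real, Real.norm_eq_abs,
      abs_of_nonneg (by positivity : 0 ≤ K * Real.exp (h * s ^ 2 / 4))] at e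
    rw [e, mul_assoc]
  rcases le_total 1 (h * s) with hhs | hhs
  · have hs0 : 0 < s := pos_of_mul_pos_right (by linarith) h0.le
    rw [e (h * s) hhs]
    have b3 := exp_neg_quarter_le_of_one_le_mul h0 hhs
    calc _ ≤ 1 * (M0 * Real.exp (-(h * s ^ 2 / 4))) := by
          exact mul_le_mul hK1 (norm_edgeIntegral_large_le (a := diffAmplitude)
            (fun z hz => norm_diffAmplitude_le_one hz) h0 h1 hN hhs) (by positivity) zero_le_one
      _ ≤ 1 * (M0 * Real.exp (-(s / 4))) := by gcongr; nlinarith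
      _ ≤ 1 * (M0 * (128 * h ^ 2 * Real.exp (-(s / 8)))) := by gcongr
      _ = (128 * M0) * (h * h) * Real.exp (-(s / 8)) := by ring
      _ ≤ (128 * M0) * (1 * h) * Real.exp (-(s / 8)) := by gcongr; linarith
      _ = (128 * M0) * h * Real.exp (-(s / 8)) := by ring
      _ ≤ _ := by
        have : 0 ≤ 2 * M1 * A * B := by positivity
        exact mul_le_mul_of_nonneg_right (mul_le_mul_of_nonneg_right (by linarith) h0.le)
          (Real.exp_pos _).le
  · rw [e 1 le_rfl]
    have hey := exp_mul_sq_quarter_le h0 h1 hS hs hhs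
    have a1 := exp_neg_mul_le (a := 3 / 4) hs hS (by norm_num) (by norm_num)
    calc _ ≤ 1 * ((A * Real.exp (s / 4)) * (h * (2 * M1 * Real.exp (-s)))) := by
          gcongr
          exact norm_edgeIntegral_diff_le h0 h1 hN s
      _ = h * (2 * M1 * A) * (Real.exp (s / 4) * Real.exp (-s)) := by ring
      _ = h * (2 * M1 * A) * Real.exp (-(3 / 4 * s)) := by rw [← Real.exp_add]; ring_nf
      _ ≤ h * (2 * M1 * A) * (B * Real.exp (-(s / 8))) := by gcongr
      _ = (2 * M1 * A * B) * h * Real.exp (-(s / 8)) := by ring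
      _ ≤ _ := mul_le_mul_of_nonneg_right (mul_le_mul_of_nonneg_right (by linarith) h0.le)
          (Real.exp_pos _).le

end EdgeIntegral

section HermiteIntegral

/-- The contour integral `∫ w^n e^{w² - 2xw}` along the vertical line `Re w = a`. -/
noncomputable def hermiteLine (n : ℕ) (a x : ℝ) : ℂ :=
  ∫ t : ℝ, vline a t ^ n * Complex.exp (vline a t ^ 2 - 2 * x * vline a t)

theorem norm_hermiteLine_integrand_le (n : ℕ) (a x t : ℝ) :
    ‖vline a t ^ n * Complex.exp (vline a t ^ 2 - 2 * x * vline a t)‖ ≤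
      (1 + |a|) ^ n * Real.exp (a ^ 2 - 2 * x * a) * ((1 + |t|) ^ n * Real.exp (-t ^ 2 / 2)) := by
  have hre : (vline a t ^ 2 - 2 * x * vline a t).re = a ^ 2 - 2 * x * a + -t ^ 2 := by
    rw [Complex.sub_re, sq, Complex.mul_re, show (2 * (x : ℂ)) = ((2 * x : ℝ) : ℂ) by push_cast; rfl,
      Complex.re_ofReal_mul, vline_re, vline_im]
    ring
  have h1 : ‖vline a t‖ ≤ (1 + |a|) * (1 + |t|) :=
    (norm_vline_le a t).trans (by nlinarith [mul_nonneg (abs_nonneg a) (abs_nonneg t)])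
  rw [norm_mul, norm_pow, Complex.norm_exp, hre, Real.exp_add]
  calc _ ≤ ((1 + |a|) * (1 + |t|)) ^ n *
        (Real.exp (a ^ 2 - 2 * x * a) * Real.exp (-t ^ 2 / 2)) := by
        gcongr
        nlinarith [sq_nonneg t]
    _ = _ := by rw [mul_pow]; ring

theorem continuous_hermiteLine_integrand (n : ℕ) (a x : ℝ) : Continuous fun t : ℝ =>
    vline a t ^ n * Complex.exp (vline a t ^ 2 - 2 * x * vline a t) := by fun_prop

theorem integrable_hermiteLine_integrand (n : ℕ) (a x : ℝ) : Integrable fun t : ℝ =>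
    vline a t ^ n * Complex.exp (vline a t ^ 2 - 2 * x * vline a t) :=
  integrable_of_norm_le_gaussian (continuous_hermiteLine_integrand n a x)
    (norm_hermiteLine_integrand_le n a x)

theorem hasDerivAt_hermiteLine (n : ℕ) (a x : ℝ) :
    HasDerivAt (hermiteLine n a) (-2 * hermiteLine (n + 1) a x) x := by
  have key := hasDerivAt_integral_of_dominated_loc_of_deriv_le (μ := (volume : Measure ℝ))
    (F := fun (y : ℝ) (t : ℝ) => vline a t ^ n * Complex.exp (vline a t ^ 2 - 2 * y * vline a t))
    (F' := fun (y : ℝ) (t : ℝ) =>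
      -2 * (vline a t ^ (n + 1) * Complex.exp (vline a t ^ 2 - 2 * y * vline a t)))
    (bound := fun t => 2 * ((1 + |a|) ^ (n + 1) * Real.exp (a ^ 2 + 2 * (|x| + 1) * |a|) *
      ((1 + |t|) ^ (n + 1) * Real.exp (-t ^ 2 / 2))))
    (x₀ := x) (s := Metric.ball x 1) (Metric.ball_mem_nhds x one_pos)
    (Eventually.of_forall fun y => (continuous_hermiteLine_integrand n a y).aestronglyMeasurable)
    (integrable_hermiteLine_integrand n a x)
    (continuous_const.mul (continuous_hermiteLine_integrand (n + 1) a x)).aestronglyMeasurable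
    (Eventually.of_forall fun t y hy => ?_)
    (((integrable_one_add_abs_pow_mul_gaussian (n + 1)).const_mul _).const_mul _)
    (Eventually.of_forall fun t y _ => ?_)
  · have := key.2
    rwa [integral_const_mul] at this
  · rw [norm_mul]
    have hy' : |y| ≤ |x| + 1 := by
      have h1 : |y - x| < 1 := by simpa [Real.dist_eq] using hy
      have h2 := abs_sub_abs_le_abs_sub y x
      linarith
    have hxa : -(2 * y * a) ≤ 2 * (|x| + 1) * |a| := by
      have h1 := neg_abs_le (y * a)
      rw [abs_mul] at h1
      nlinarith [mul_le_mul_of_nonneg_right hy' (abs_nonneg a)]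
    rw [norm_neg, Complex.norm_ofNat]
    refine mul_le_mul_of_nonneg_left ((norm_hermiteLine_integrand_le (n + 1) a y t).trans ?_)
      zero_le_two
    gcongr
    linarith
  · have h1 : HasDerivAt (fun y : ℝ => vline a t ^ 2 - 2 * (y : ℂ) * vline a t)
        (-(2 * 1 * vline a t)) y :=
      (((Complex.ofRealCLM.hasDerivAt (x := y)).const_mul 2).mul_const (vline a t)).const_sub _
    refine (h1.cexp.const_mul (vline a t ^ n)).congr_deriv ?_
    ring

theorem hermiteLine_zero (a x : ℝ) : hermiteLine 0 a x = (Real.sqrt π * Real.exp (-x ^ 2) : ℝ) := by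
  have h := integral_cexp_quadratic (b := -1) (by norm_num) (2 * Complex.I * (a - x))
    (a ^ 2 - 2 * x * a)
  have e : hermiteLine 0 a x = ∫ t : ℝ, Complex.exp (-1 * (t : ℂ) ^ 2 +
      2 * Complex.I * (a - x) * t + (a ^ 2 - 2 * x * a)) := by
    unfold hermiteLine
    refine integral_congr_ae (Eventually.of_forall fun t => ?_)
    simp only [pow_zero, one_mul, vline]
    congr 1
    linear_combination (t : ℂ) ^ 2 * Complex.I_sq
  rw [e, h]
  push_cast
  congr 1
  · rw [neg_neg, div_one, Real.sqrt_eq_rpow, Complex.ofReal_cpow Real.pi_pos.le]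
    norm_num
  · congr 1
    linear_combination ((a : ℂ) - x) ^ 2 * Complex.I_sq

theorem ofReal_iteratedDeriv_exp_neg_sq (n : ℕ) (a x : ℝ) :
    ((iteratedDeriv n (fun t : ℝ => Real.exp (-t ^ 2)) x : ℝ) : ℂ) =
      (-2) ^ n / (Real.sqrt π : ℂ) * hermiteLine n a x := by
  have hπ : (Real.sqrt π : ℂ) ≠ 0 := by
    rw [Complex.ofReal_ne_zero]; exact (Real.sqrt_pos.2 Real.pi_pos).ne'
  induction n generalizing x with
  | zero =>
    rw [iteratedDeriv_zero, hermiteLine_zero]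
    push_cast
    field_simp
  | succ n ih =>
    have hs : ContDiff ℝ ⊤ (fun t : ℝ => Real.exp (-t ^ 2)) := by fun_prop
    have hd := (hs.differentiable_iteratedDeriv n (by exact_mod_cast WithTop.coe_lt_top _)
      x).hasDerivAt
    rw [← iteratedDeriv_succ] at hd
    have h1 := hd.ofReal_comp
    have h2 := (hasDerivAt_hermiteLine n a x).const_mul ((-2) ^ n / (Real.sqrt π : ℂ))
    rw [funext ih] at h1
    rw [h1.unique h2, pow_succ]
    ring

theorem ofReal_physHermite (n : ℕ) (a x : ℝ) :
    (physHermite n x : ℂ) = (2 ^ n / Real.sqrt π * Real.exp (x ^ 2) : ℝ) * hermiteLine n a x := by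
  have h : (-1 : ℂ) ^ n * (-2) ^ n = 2 ^ n := by rw [← mul_pow]; norm_num
  rw [physHermite]
  push_cast [ofReal_iteratedDeriv_exp_neg_sq n a x]
  rw [← h]
  ring

theorem hasDerivAt_physHermite (n : ℕ) (x : ℝ) :
    HasDerivAt (physHermite n) (2 * x * physHermite n x - physHermite (n + 1) x) x := by
  have hs : ContDiff ℝ ⊤ (fun t : ℝ => Real.exp (-t ^ 2)) := by fun_prop
  have hd := (hs.differentiable_iteratedDeriv n (by exact_mod_cast WithTop.coe_lt_top _)
    x).hasDerivAt
  rw [← iteratedDeriv_succ] at hd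
  have he : HasDerivAt (fun x : ℝ => (-1 : ℝ) ^ n * Real.exp (x ^ 2))
      ((-1) ^ n * (Real.exp (x ^ 2) * (2 * x))) x := by
    have := ((hasDerivAt_pow 2 x).exp).const_mul ((-1 : ℝ) ^ n)
    simpa using this
  refine (he.mul hd).congr_deriv ?_
  simp only [physHermite, pow_succ]
  ring

end HermiteIntegral

section OscillatorKernel

theorem physHermite_zero (x : ℝ) : physHermite 0 x = 1 := by
  simp [physHermite, ← Real.exp_add]

theorem hasDerivAt_physHermite_succ (n : ℕ) (x : ℝ) :
    HasDerivAt (physHermite (n + 1)) (2 * (n + 1) * physHermite n x) x := by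
  induction n generalizing x with
  | zero =>
    have h1 : ∀ x, physHermite 1 x = 2 * x := by
      intro x
      have h := hasDerivAt_physHermite 0 x
      have h' : HasDerivAt (physHermite 0) 0 x := by
        rw [show physHermite 0 = fun _ => 1 from funext physHermite_zero]
        exact hasDerivAt_const x 1
      have := h.unique h'
      rw [physHermite_zero] at this
      linarith
    rw [zero_add, funext h1, physHermite_zero]
    simpa using (hasDerivAt_id x).const_mul 2
  | succ n ih =>
    have hrec : ∀ x, physHermite (n + 2) x =
        2 * x * physHermite (n + 1) x - 2 * (n + 1) * physHermite n x := by
      intro x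
      have := (hasDerivAt_physHermite (n + 1) x).unique (ih x)
      linarith
    rw [show n + 1 + 1 = n + 2 from rfl, funext hrec]
    refine ((((hasDerivAt_id x).const_mul 2).mul (ih x)).sub
      ((hasDerivAt_physHermite n x).const_mul (2 * ((n : ℝ) + 1)))).congr_deriv ?_
    push_cast
    simp only [id]
    ring

theorem hNorm_pos (n : ℕ) : 0 < hNorm n := by
  unfold hNorm; have := Real.pi_pos; positivity

theorem hNorm_succ (n : ℕ) : hNorm (n + 1) = 2 * (n + 1) * hNorm n := by
  simp only [hNorm, Nat.factorial_succ, pow_succ]; push_cast; ring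

theorem hNorm_succ_rpow (n : ℕ) :
    hNorm n ^ (-(1 : ℝ) / 2) = Real.sqrt (2 * (n + 1)) * hNorm (n + 1) ^ (-(1 : ℝ) / 2) := by
  have h : (0 : ℝ) < 2 * (n + 1) := by positivity
  rw [hNorm_succ, Real.mul_rpow h.le (hNorm_pos n).le, ← mul_assoc, Real.sqrt_eq_rpow,
    ← Real.rpow_add h]
  norm_num

theorem hasDerivAt_exp_neg_sq_half (x : ℝ) :
    HasDerivAt (fun x : ℝ => Real.exp (-x ^ 2 / 2)) (-x * Real.exp (-x ^ 2 / 2)) x := by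
  refine (((hasDerivAt_pow 2 x).neg.div_const 2).exp).congr_deriv ?_
  simp; ring

theorem hasDerivAt_osc (n : ℕ) (x : ℝ) :
    HasDerivAt (osc n) (x * osc n x - Real.sqrt (2 * (n + 1)) * osc (n + 1) x) x := by
  refine ((((hasDerivAt_exp_neg_sq_half x).const_mul (hNorm n ^ (-(1 : ℝ) / 2))).mul
    (hasDerivAt_physHermite n x))).congr_deriv ?_
  simp only [osc, hNorm_succ_rpow n]
  ring

theorem hasDerivAt_osc_succ (n : ℕ) (x : ℝ) :
    HasDerivAt (osc (n + 1)) (-x * osc (n + 1) x + Real.sqrt (2 * (n + 1)) * osc n x) x := by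
  refine ((((hasDerivAt_exp_neg_sq_half x).const_mul (hNorm (n + 1) ^ (-(1 : ℝ) / 2))).mul
    (hasDerivAt_physHermite_succ n x))).congr_deriv ?_
  have hs : Real.sqrt (2 * ((n : ℝ) + 1)) * Real.sqrt (2 * (n + 1)) = 2 * (n + 1) :=
    Real.mul_self_sqrt (by positivity)
  simp only [osc, hNorm_succ_rpow n]
  linear_combination -(hNorm (n + 1) ^ (-(1 : ℝ) / 2) * Real.exp (-x ^ 2 / 2) * physHermite n x) * hs

theorem continuous_osc (n : ℕ) : Continuous (osc n) :=
  continuous_iff_continuousAt.2 fun x => (hasDerivAt_osc n x).continuousAt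

theorem exists_polynomial_physHermite (n : ℕ) :
    ∃ p : Polynomial ℝ, ∀ x, physHermite n x = p.eval x := by
  induction n with
  | zero => exact ⟨1, fun x => by rw [physHermite_zero, Polynomial.eval_one]⟩
  | succ n ih =>
    obtain ⟨p, hp⟩ := ih
    refine ⟨Polynomial.C 2 * Polynomial.X * p - Polynomial.derivative p, fun x => ?_⟩
    have h := hasDerivAt_physHermite n x
    rw [funext hp] at h
    have := h.unique (p.hasDerivAt x)
    simp only [Polynomial.eval_sub, Polynomial.eval_mul, Polynomial.eval_C, Polynomial.eval_X]
    linarith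

theorem tendsto_osc_atTop (n : ℕ) : Tendsto (osc n) atTop (nhds 0) := by
  obtain ⟨p, hp⟩ := exists_polynomial_physHermite n
  have h1 := (p.tendsto_div_exp_atTop.abs).const_mul (hNorm n ^ (-(1 : ℝ) / 2) * Real.exp (1 / 2))
  rw [abs_zero, mul_zero] at h1
  refine squeeze_zero_norm (fun x => ?_) h1
  have h0 := hNorm_pos n
  rw [osc, hp, Real.norm_eq_abs, abs_mul, abs_div, abs_of_pos (Real.exp_pos x), abs_of_pos
    (by positivity : 0 < hNorm n ^ (-(1 : ℝ) / 2) * Real.exp (-x ^ 2 / 2))]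
  have h2 : Real.exp (-x ^ 2 / 2) ≤ Real.exp (1 / 2) / Real.exp x := by
    rw [← Real.exp_sub]
    apply Real.exp_le_exp.2
    nlinarith [sq_nonneg (x - 1)]
  calc _ ≤ hNorm n ^ (-(1 : ℝ) / 2) * (Real.exp (1 / 2) / Real.exp x) * |p.eval x| := by gcongr
    _ = _ := by ring

theorem hasDerivAt_osc_zero (x : ℝ) :
    HasDerivAt (osc 0) (-(Real.sqrt (2 * ((0 : ℕ) + 1)) / 2 * osc 1 x)) x := by
  have h1 := hasDerivAt_osc 0 x
  have h2 : HasDerivAt (osc 0) (-x * osc 0 x) x := by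
    have := (hasDerivAt_exp_neg_sq_half x).const_mul (hNorm 0 ^ (-(1 : ℝ) / 2))
    have e : osc 0 = fun x => hNorm 0 ^ (-(1 : ℝ) / 2) * Real.exp (-x ^ 2 / 2) := by
      funext y; rw [osc, physHermite_zero, mul_one]
    rw [e]
    exact this.congr_deriv (by ring)
  refine h1.congr_deriv ?_
  have h := h1.unique h2
  norm_num at h ⊢
  linarith

theorem hasDerivAt_osc_succ_average (n : ℕ) (x : ℝ) :
    HasDerivAt (osc (n + 1)) (Real.sqrt (2 * (n + 1)) / 2 * osc n x -
      Real.sqrt (2 * ((n + 1 : ℕ) + 1)) / 2 * osc (n + 2) x) x := by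
  have h1 := hasDerivAt_osc (n + 1) x
  have h2 := hasDerivAt_osc_succ n x
  refine h1.congr_deriv ?_
  linarith [h1.unique h2]

/-- The derivative of the kernel along the diagonal direction (Christoffel–Darboux). -/
theorem hasDerivAt_SN2_add (N : ℕ) (x y : ℝ) {z : ℝ} :
    HasDerivAt (fun z => SN2 (N + 1) (x + z) (y + z))
      (-(Real.sqrt (2 * (N + 1)) / 2 * (osc (N + 1) (x + z) * osc N (y + z) +
        osc N (x + z) * osc (N + 1) (y + z)))) z := by
  induction N with
  | zero =>
    have hx := (hasDerivAt_osc_zero (x + z)).comp_const_add x z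
    have hy := (hasDerivAt_osc_zero (y + z)).comp_const_add y z
    simp only [SN2, zero_add, Finset.sum_range_one]
    exact (hx.mul hy).congr_deriv (by ring)
  | succ N ih =>
    have hx := (hasDerivAt_osc_succ_average N (x + z)).comp_const_add x z
    have hy := (hasDerivAt_osc_succ_average N (y + z)).comp_const_add y z
    have e : (fun z => SN2 (N + 1 + 1) (x + z) (y + z)) = fun z =>
        SN2 (N + 1) (x + z) (y + z) + osc (N + 1) (x + z) * osc (N + 1) (y + z) := by
      funext w; simp only [SN2, Finset.sum_range_succ]
    rw [e]
    exact (ih.add (hx.mul hy)).congr_deriv (by ring)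

theorem tendsto_SN2_add (N : ℕ) (x y : ℝ) :
    Tendsto (fun z => SN2 N (x + z) (y + z)) atTop (nhds 0) := by
  have h : ∀ k ∈ Finset.range N, Tendsto (fun z => osc k (x + z) * osc k (y + z)) atTop
      (nhds (0 * 0)) := fun k _ =>
    ((tendsto_osc_atTop k).comp (tendsto_atTop_add_const_left _ x tendsto_id)).mul
      ((tendsto_osc_atTop k).comp (tendsto_atTop_add_const_left _ y tendsto_id))
  simpa [SN2] using tendsto_finsetSum _ h

/-- The kernel as an integral over the shifted product of consecutive wave functions. -/
theorem mul_SN2_eq_integral (N : ℕ) {τ : ℝ} (hτ : 0 < τ) (x y : ℝ)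
    (hi : IntegrableOn (fun z => τ * (Real.sqrt (2 * (N + 1)) / 2 *
      (osc (N + 1) (x + τ * z) * osc N (y + τ * z) +
        osc N (x + τ * z) * osc (N + 1) (y + τ * z)))) (Set.Ioi 0)) :
    SN2 (N + 1) x y = ∫ z in Set.Ioi (0 : ℝ), τ * (Real.sqrt (2 * (N + 1)) / 2 *
      (osc (N + 1) (x + τ * z) * osc N (y + τ * z) +
        osc N (x + τ * z) * osc (N + 1) (y + τ * z))) := by
  have hd : ∀ z : ℝ, HasDerivAt (fun z => -SN2 (N + 1) (x + τ * z) (y + τ * z))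
      (τ * (Real.sqrt (2 * (N + 1)) / 2 * (osc (N + 1) (x + τ * z) * osc N (y + τ * z) +
        osc N (x + τ * z) * osc (N + 1) (y + τ * z)))) z := by
    intro z
    have h1 : HasDerivAt (fun z : ℝ => τ * z) τ z := by
      simpa using (hasDerivAt_id z).const_mul τ
    have h2 : HasDerivAt (fun z => SN2 (N + 1) (x + z) (y + z)) _ (τ * z) := hasDerivAt_SN2_add N x y
    exact (h2.comp z h1).neg.congr_deriv (by ring)
  have ht : Tendsto (fun z => -SN2 (N + 1) (x + τ * z) (y + τ * z)) atTop (nhds 0) := by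
    have := ((tendsto_SN2_add (N + 1) x y).comp
      ((tendsto_const_mul_atTop_of_pos hτ).2 tendsto_id)).neg
    simpa [Function.comp_def] using this
  have := integral_Ioi_of_hasDerivAt_of_tendsto (hd 0).continuousAt.continuousWithinAt
    (fun z _ => hd z) hi ht
  rw [this]
  simp

end OscillatorKernel

section EdgeScaling

variable {N : ℕ} {h r : ℝ}

theorem hermiteLine_edge (n : ℕ) (h0 : 0 < h) (hN : (N : ℝ) * h ^ 3 = 1) (hr0 : 0 < r)
    (hr : 2 * r ^ 2 = N) (c u : ℝ) (b : ℂ → ℂ)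
    (hb : ∀ v, b (h * vline c v) * (1 + h * vline c v) ^ N = (1 + h * vline c v) ^ n) :
    (Real.exp ((2 * r + u / (2 * r * h)) ^ 2 / 2) : ℝ) *
      hermiteLine n (r * (1 + h * c)) (2 * r + u / (2 * r * h)) =
      (r ^ (n + 1) * h * Real.exp (-r ^ 2) * Real.exp (h * u ^ 2 / 4) : ℝ) *
        edgeIntegral b N h c u := by
  have hrh : 0 < r * h := by positivity
  have hv : ∀ v : ℝ, vline (r * (1 + h * c)) (r * h * v) = r * (1 + h * vline c v) := by
    intro v; simp only [vline]; push_cast; ring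
  have hcv := Measure.integral_comp_mul_left (fun t : ℝ => vline (r * (1 + h * c)) t ^ n *
    Complex.exp (vline (r * (1 + h * c)) t ^ 2 - 2 * (2 * r + u / (2 * r * h) : ℝ) *
      vline (r * (1 + h * c)) t)) (r * h)
  rw [abs_of_pos (inv_pos.2 hrh)] at hcv
  have e1 : hermiteLine n (r * (1 + h * c)) (2 * r + u / (2 * r * h)) = (r * h : ℝ) *
      ∫ v : ℝ, (r * (1 + h * vline c v)) ^ n * Complex.exp ((r * (1 + h * vline c v)) ^ 2 -
        2 * (2 * r + u / (2 * r * h) : ℝ) * (r * (1 + h * vline c v))) := by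
    simp only [hv] at hcv
    rw [hcv, hermiteLine, Complex.real_smul, ← mul_assoc, ← Complex.ofReal_mul,
      mul_inv_cancel₀ hrh.ne', Complex.ofReal_one, one_mul]
  have e2 : ∀ v : ℝ, (r * (1 + h * vline c v)) ^ n * Complex.exp ((r * (1 + h * vline c v)) ^ 2 -
        2 * (2 * r + u / (2 * r * h) : ℝ) * (r * (1 + h * vline c v))) =
      (r ^ n * Real.exp (-3 * r ^ 2 - u / h) : ℝ) * (b (h * vline c v) *
        hermitePhase N (h * vline c v) * Complex.exp (-(u * vline c v))) := by
    intro v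
    have hh : (h : ℂ) ≠ 0 := by exact_mod_cast h0.ne'
    have hrc : (r : ℂ) ≠ 0 := by exact_mod_cast hr0.ne'
    have hNc : (2 : ℂ) * r ^ 2 = N := by exact_mod_cast hr
    rw [hermitePhase, mul_pow (1 + _), ← Complex.exp_nat_mul, ← mul_assoc (b _), hb, mul_pow]
    have hexp : Complex.exp ((r * (1 + h * vline c v)) ^ 2 -
        2 * (2 * r + u / (2 * r * h) : ℝ) * (r * (1 + h * vline c v))) =
        Complex.exp ((-3 * r ^ 2 - u / h : ℝ) : ℂ) *
        Complex.exp (N * (-(h * vline c v) + (h * vline c v) ^ 2 / 2)) *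
          Complex.exp (-(u * vline c v)) := by
      rw [← Complex.exp_add, ← Complex.exp_add, ← hNc]
      congr 1
      push_cast
      field_simp
      ring
    rw [hexp]
    push_cast
    ring
  rw [e1, integral_congr_ae (Eventually.of_forall e2), integral_const_mul, ← edgeIntegral,
    ← mul_assoc, ← mul_assoc, ← Complex.ofReal_mul, ← Complex.ofReal_mul]
  congr 2
  have hx : (2 * r + u / (2 * r * h)) ^ 2 / 2 = 2 * r ^ 2 + u / h + h * u ^ 2 / 4 := by
    have h3 : 2 * r ^ 2 * h ^ 3 = 1 := by rw [hr]; exact hN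
    field_simp
    linear_combination (-4 * u ^ 2) * h3
  calc _ = r ^ (n + 1) * h * (Real.exp ((2 * r + u / (2 * r * h)) ^ 2 / 2) *
        Real.exp (-3 * r ^ 2 - u / h)) := by ring
    _ = r ^ (n + 1) * h * (Real.exp (-r ^ 2) * Real.exp (h * u ^ 2 / 4)) := by
        rw [← Real.exp_add, ← Real.exp_add, hx]; ring_nf
    _ = _ := by ring

theorem ofReal_osc_edge (n : ℕ) (h0 : 0 < h) (hN : (N : ℝ) * h ^ 3 = 1) (hr0 : 0 < r)
    (hr : 2 * r ^ 2 = N) (c u : ℝ) (b : ℂ → ℂ)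
    (hb : ∀ v, b (h * vline c v) * (1 + h * vline c v) ^ N = (1 + h * vline c v) ^ n) :
    (osc n (2 * r + u / (2 * r * h)) : ℂ) =
      (hNorm n ^ (-(1 : ℝ) / 2) * (2 ^ n / Real.sqrt π) * (r ^ (n + 1) * h * Real.exp (-r ^ 2)) *
        Real.exp (h * u ^ 2 / 4) : ℝ) * edgeIntegral b N h c u := by
  set x := 2 * r + u / (2 * r * h) with hx
  have e := hermiteLine_edge n h0 hN hr0 hr c u b hb
  rw [← hx] at e
  have e2 : Real.exp (-x ^ 2 / 2) * Real.exp (x ^ 2) = Real.exp (x ^ 2 / 2) := by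
    rw [← Real.exp_add]; ring_nf
  rw [osc, Complex.ofReal_mul, ofReal_physHermite n (r * (1 + h * c)) x]
  calc _ = ((hNorm n ^ (-(1 : ℝ) / 2) * (2 ^ n / Real.sqrt π) : ℝ) : ℂ) *
        ((Real.exp (-x ^ 2 / 2) * Real.exp (x ^ 2) : ℝ) * hermiteLine n (r * (1 + h * c)) x) := by
        push_cast; ring
    _ = _ := by rw [e2, e]; push_cast; ring

/-- The normalizing constant of the edge-scaled wave function `osc N`. -/
noncomputable def edgeConst (N : ℕ) (h r : ℝ) : ℝ :=
  1 / (h * Real.sqrt (2 * r)) * (hNorm N ^ (-(1 : ℝ) / 2) * (2 ^ N / Real.sqrt π) *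
    (r ^ (N + 1) * h * Real.exp (-r ^ 2)))

theorem ofReal_osc_edge_self (h0 : 0 < h) (hN : (N : ℝ) * h ^ 3 = 1) (hr0 : 0 < r)
    (hr : 2 * r ^ 2 = N) (c u : ℝ) :
    ((1 / (h * Real.sqrt (2 * r)) * osc N (2 * r + u / (2 * r * h)) : ℝ) : ℂ) =
      (edgeConst N h r * Real.exp (h * u ^ 2 / 4) : ℝ) * edgeIntegral (fun _ => 1) N h c u := by
  rw [Complex.ofReal_mul, ofReal_osc_edge N h0 hN hr0 hr c u (fun _ => 1) (by simp), edgeConst]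
  push_cast; ring

theorem ofReal_osc_edge_pred {n : ℕ} (h0 : 0 < h) (hN : ((n + 1 : ℕ) : ℝ) * h ^ 3 = 1) (hr0 : 0 < r)
    (hr : 2 * r ^ 2 = (n + 1 : ℕ)) {c : ℝ} (hc : 0 ≤ c) (u : ℝ) :
    ((1 / (h * Real.sqrt (2 * r)) * osc n (2 * r + u / (2 * r * h)) : ℝ) : ℂ) =
      (edgeConst (n + 1) h r * Real.exp (h * u ^ 2 / 4) : ℝ) *
        edgeIntegral (fun z => (1 + z)⁻¹) (n + 1) h c u := by
  have hs : Real.sqrt (2 * (n + 1)) = 2 * r := by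
    rw [show 2 * ((n : ℝ) + 1) = (2 * r) ^ 2 by push_cast at hr; linarith]
    exact Real.sqrt_sq (by positivity)
  rw [Complex.ofReal_mul, ofReal_osc_edge n h0 hN hr0 hr c u (fun z => (1 + z)⁻¹) fun v => ?_,
    edgeConst, hNorm_succ_rpow, hs]
  · push_cast; ring
  · have := one_add_ne_zero_of_re_nonneg (mul_vline_re_nonneg h0 hc v)
    rw [pow_succ]; field_simp

theorem integrable_edge_integrand {a : ℂ → ℂ} (ha : ∀ z : ℂ, 0 ≤ z.re → ‖a z‖ ≤ 1)
    (h0 : 0 < h) (h1 : h ≤ 1 / 2) (hN : (N : ℝ) * h ^ 3 = 1) {c : ℝ} (hc : 1 ≤ c)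
    (hac : Continuous fun v => a (h * vline c v)) (s : ℝ) : Integrable fun v : ℝ =>
      a (h * vline c v) * hermitePhase N (h * vline c v) * Complex.exp (-(s * vline c v)) := by
  refine integrable_of_norm_le_gaussian (m := 0)
    (K := ((1 + h * c) * Real.exp (-(h * c) + (h * c) ^ 2 / 2)) ^ N * Real.exp (-(s * c)))
    ((hac.mul (by fun_prop)).mul (by fun_prop)) fun v => ?_
  rw [norm_mul, norm_mul, norm_exp_neg_mul_vline]
  calc _ ≤ 1 * (((1 + h * c) * Real.exp (-(h * c) + (h * c) ^ 2 / 2)) ^ N *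
        Real.exp (-v ^ 2 / 2)) * Real.exp (-(s * c)) := by
        gcongr
        · exact ha _ (mul_vline_re_nonneg h0 (by linarith) v)
        · exact norm_hermitePhase_le h0 h1 hN hc v
    _ = _ := by ring

theorem edgeIntegral_sumAmplitude (h0 : 0 < h) (h1 : h ≤ 1 / 2) (hN : (N : ℝ) * h ^ 3 = 1) {c : ℝ}
    (hc : 1 ≤ c) (s : ℝ) : edgeIntegral sumAmplitude N h c s =
      (edgeIntegral (fun _ => 1) N h c s + edgeIntegral (fun z => (1 + z)⁻¹) N h c s) / 2 := by
  have i1 := integrable_edge_integrand (a := fun _ => 1) (by simp) h0 h1 hN hc continuous_const s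
  have i2 := integrable_edge_integrand (a := fun z => (1 + z)⁻¹) (fun z => norm_inv_one_add_le) h0
    h1 hN hc (continuous_inv_one_add_mul_vline h0 (by linarith)) s
  simp only [edgeIntegral]
  rw [← integral_add i1 i2, ← integral_div]
  congr 1; funext v
  simp only [sumAmplitude]; ring

theorem edgeIntegral_diffAmplitude (h0 : 0 < h) (h1 : h ≤ 1 / 2) (hN : (N : ℝ) * h ^ 3 = 1) {c : ℝ}
    (hc : 1 ≤ c) (s : ℝ) : edgeIntegral diffAmplitude N h c s =
      (edgeIntegral (fun _ => 1) N h c s - edgeIntegral (fun z => (1 + z)⁻¹) N h c s) / 2 := by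
  have i1 := integrable_edge_integrand (a := fun _ => 1) (by simp) h0 h1 hN hc continuous_const s
  have i2 := integrable_edge_integrand (a := fun z => (1 + z)⁻¹) (fun z => norm_inv_one_add_le) h0
    h1 hN hc (continuous_inv_one_add_mul_vline h0 (by linarith)) s
  simp only [edgeIntegral]
  rw [← integral_sub i1 i2, ← integral_div]
  congr 1; funext v
  simp only [diffAmplitude]; ring

/-- The edge-scaled half-sum of consecutive wave functions, which approximates `Ai`. -/
noncomputable def edgeSum (n : ℕ) (h r u : ℝ) : ℝ :=
  1 / (h * Real.sqrt (2 * r)) *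
    (osc (n + 1) (2 * r + u / (2 * r * h)) + osc n (2 * r + u / (2 * r * h))) / 2

/-- The edge-scaled half-difference of consecutive wave functions. -/
noncomputable def edgeDiff (n : ℕ) (h r u : ℝ) : ℝ :=
  1 / (h * Real.sqrt (2 * r)) *
    (osc (n + 1) (2 * r + u / (2 * r * h)) - osc n (2 * r + u / (2 * r * h))) / 2

theorem ofReal_edgeSum {n : ℕ} (h0 : 0 < h) (h1 : h ≤ 1 / 2) (hN : ((n + 1 : ℕ) : ℝ) * h ^ 3 = 1)
    (hr0 : 0 < r) (hr : 2 * r ^ 2 = (n + 1 : ℕ)) {c : ℝ} (hc : 1 ≤ c) (u : ℝ) :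
    (edgeSum n h r u : ℂ) = (edgeConst (n + 1) h r * Real.exp (h * u ^ 2 / 4) : ℝ) *
      edgeIntegral sumAmplitude (n + 1) h c u := by
  rw [edgeIntegral_sumAmplitude h0 h1 hN hc u, mul_div_assoc', mul_add,
    ← ofReal_osc_edge_self h0 hN hr0 hr, ← ofReal_osc_edge_pred h0 hN hr0 hr (by linarith), edgeSum]
  push_cast; ring

theorem ofReal_edgeDiff {n : ℕ} (h0 : 0 < h) (h1 : h ≤ 1 / 2) (hN : ((n + 1 : ℕ) : ℝ) * h ^ 3 = 1)
    (hr0 : 0 < r) (hr : 2 * r ^ 2 = (n + 1 : ℕ)) {c : ℝ} (hc : 1 ≤ c) (u : ℝ) :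
    (edgeDiff n h r u : ℂ) = (edgeConst (n + 1) h r * Real.exp (h * u ^ 2 / 4) : ℝ) *
      edgeIntegral diffAmplitude (n + 1) h c u := by
  rw [edgeIntegral_diffAmplitude h0 h1 hN hc u, mul_div_assoc', mul_sub,
    ← ofReal_osc_edge_self h0 hN hr0 hr, ← ofReal_osc_edge_pred h0 hN hr0 hr (by linarith), edgeDiff]
  push_cast; ring

theorem log_stirlingSeq_sub_le {n : ℕ} (hn : n ≠ 0) :
    Real.log (Stirling.stirlingSeq n) - Real.log (Real.sqrt π) ≤ 1 / (12 * n) := by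
  have hpi : 0 < Real.sqrt π := Real.sqrt_pos.2 Real.pi_pos
  have hstep : ∀ k : ℕ, Real.log (Stirling.stirlingSeq n) -
      Real.log (Stirling.stirlingSeq (n + k)) ≤ 1 / (12 * n) - 1 / (12 * (n + k : ℕ)) := by
    intro k
    induction k with
    | zero => simp
    | succ k ih =>
      have h := Stirling.log_stirlingSeq_sdiff_le (n + k)
      have hp : (0 : ℝ) < (n + k : ℕ) := by exact_mod_cast (by omega : 0 < n + k)
      have e : 1 / (12 * ((n + k : ℕ) : ℝ) * ((n + k : ℕ) + 1)) =
          1 / (12 * (n + k : ℕ)) - 1 / (12 * ((n + k : ℕ) + 1)) := by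
        field_simp; ring
      rw [e] at h
      rw [← add_assoc, Nat.cast_succ (n + k)]
      linarith
  have hlim : Tendsto (fun k : ℕ => Real.log (Stirling.stirlingSeq n) -
      Real.log (Stirling.stirlingSeq (k + n))) atTop
      (nhds (Real.log (Stirling.stirlingSeq n) - Real.log (Real.sqrt π))) :=
    tendsto_const_nhds.sub (((tendsto_add_atTop_iff_nat n).2
      Stirling.tendsto_stirlingSeq_sqrt_pi).log hpi.ne')
  refine le_of_tendsto' hlim fun k => ?_
  rw [add_comm k n]
  refine (hstep k).trans ?_
  have : (0 : ℝ) ≤ 1 / (12 * (n + k : ℕ)) := by positivity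
  linarith

theorem edgeConst_sq (h0 : 0 < h) (hr0 : 0 < r) (hr : 2 * r ^ 2 = N) :
    edgeConst N h r ^ 2 = 1 / (4 * (π * Real.sqrt π) * Stirling.stirlingSeq N) := by
  have hs : Real.sqrt (2 * (N : ℝ)) = 2 * r := by
    rw [show 2 * (N : ℝ) = (2 * r) ^ 2 by rw [← hr]; ring]
    exact Real.sqrt_sq (by positivity)
  have h2 : (hNorm N ^ (-(1 : ℝ) / 2)) ^ 2 = (hNorm N)⁻¹ := by
    rw [← Real.rpow_natCast, ← Real.rpow_mul (hNorm_pos N).le, ← Real.rpow_neg_one]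
    norm_num
  have h3 : Real.sqrt (2 * r) ^ 2 = 2 * r := Real.sq_sqrt (by positivity)
  have h4 : Real.sqrt π ^ 2 = π := Real.sq_sqrt Real.pi_pos.le
  have h5 : Real.exp (-r ^ 2) ^ 2 = (Real.exp 1 ^ N)⁻¹ := by
    rw [← Real.exp_nat_mul, ← Real.exp_nat_mul, ← Real.exp_neg, ← hr]; congr 1; push_cast; ring
  have hpi := Real.pi_pos
  have hf : (0 : ℝ) < N.factorial := by exact_mod_cast N.factorial_pos
  have hsp : 0 < Real.sqrt π := Real.sqrt_pos.2 hpi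
  have h6 : (N : ℝ) ^ N = 2 ^ N * (r ^ N) ^ 2 := by rw [← hr, mul_pow]; ring
  rw [edgeConst, Stirling.stirlingSeq, hs, div_pow, h6]
  calc _ = (1 / (h ^ 2 * Real.sqrt (2 * r) ^ 2)) * ((hNorm N ^ (-(1 : ℝ) / 2)) ^ 2 *
        ((2 ^ N) ^ 2 / Real.sqrt π ^ 2) * ((r ^ (N + 1)) ^ 2 * h ^ 2 * Real.exp (-r ^ 2) ^ 2)) := by
        ring
    _ = _ := by
        rw [h2, h3, h4, h5, hNorm, pow_succ]
        field_simp
        ring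

theorem edgeConst_nonneg (h0 : 0 < h) (hr0 : 0 < r) : 0 ≤ edgeConst N h r := by
  have := hNorm_pos N
  unfold edgeConst; positivity

theorem edgeConst_le (h0 : 0 < h) (hN0 : N ≠ 0) (hr0 : 0 < r) (hr : 2 * r ^ 2 = N) :
    edgeConst N h r ≤ 1 / (2 * π) := by
  have hpi := Real.pi_pos
  have hs := Stirling.sqrt_pi_le_stirlingSeq hN0
  have hsp : 0 < Real.sqrt π := Real.sqrt_pos.2 hpi
  have h4 : Real.sqrt π * Real.sqrt π = π := Real.mul_self_sqrt hpi.le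
  refine (sq_le_sq₀ (edgeConst_nonneg h0 hr0) (by positivity)).1 ?_
  rw [edgeConst_sq h0 hr0 hr, div_pow, one_pow]
  apply one_div_le_one_div_of_le (by positivity)
  calc (2 * π) ^ 2 = 4 * (π * Real.sqrt π) * Real.sqrt π := by
        rw [mul_assoc 4, mul_assoc π, h4]; ring
    _ ≤ _ := by gcongr

theorem abs_edgeConst_sub_le (h0 : 0 < h) (h1 : h ≤ 1 / 2) (hN : (N : ℝ) * h ^ 3 = 1) (hN0 : N ≠ 0)
    (hr0 : 0 < r) (hr : 2 * r ^ 2 = N) : |edgeConst N h r - 1 / (2 * π)| ≤ h ^ 2 := by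
  have hpi := Real.pi_pos
  have hsp : 0 < Real.sqrt π := Real.sqrt_pos.2 hpi
  have hs := Stirling.sqrt_pi_le_stirlingSeq hN0
  have hs0 : 0 < Stirling.stirlingSeq N := hsp.trans_le hs
  have h4 : Real.sqrt π * Real.sqrt π = π := Real.mul_self_sqrt hpi.le
  have hle := edgeConst_le (h := h) h0 hN0 hr0 hr
  have hK := edgeConst_nonneg (N := N) h0 hr0
  have hl := log_stirlingSeq_sub_le hN0
  have hNh : 1 / (12 * (N : ℝ)) = h ^ 3 / 12 := by
    have : (N : ℝ) ≠ 0 := by exact_mod_cast hN0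
    field_simp; linarith
  rw [hNh, ← Real.log_div hs0.ne' hsp.ne'] at hl
  have hq : 1 - h ^ 3 / 12 ≤ Real.sqrt π / Stirling.stirlingSeq N := by
    have := Real.one_sub_inv_le_log_of_pos (div_pos hsp hs0)
    have h7 : Real.sqrt π / Stirling.stirlingSeq N = Real.exp
        (-Real.log (Stirling.stirlingSeq N / Real.sqrt π)) := by
      rw [Real.exp_neg, Real.exp_log (by positivity), inv_div]
    rw [h7]
    linarith [Real.add_one_le_exp (-Real.log (Stirling.stirlingSeq N / Real.sqrt π))]
  have hsq : edgeConst N h r ^ 2 = (1 / (2 * π)) ^ 2 * (Real.sqrt π / Stirling.stirlingSeq N) := by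
    rw [edgeConst_sq h0 hr0 hr]
    field_simp
    nlinarith
  set p := 1 / (2 * π) with hp
  have hp0 : 0 < p := by positivity
  have hp1 : p ≤ 1 := by
    rw [hp, div_le_one (by positivity)]; linarith [Real.pi_gt_three]
  have hk : p * (p - edgeConst N h r) ≤ p * (p * (h ^ 3 / 12)) := by
    have : p ^ 2 * (1 - h ^ 3 / 12) ≤ edgeConst N h r ^ 2 := by rw [hsq]; gcongr
    nlinarith
  have hk' := le_of_mul_le_mul_left hk hp0
  have h3 : h ^ 3 ≤ h ^ 2 := pow_le_pow_of_le_one h0.le (by linarith) (by norm_num)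
  rw [abs_le]
  constructor <;> nlinarith [pow_pos h0 3]

end EdgeScaling

section KernelEstimate

theorem abs_Ai_add_sub_le (s : ℝ) {δ : ℝ} (hδ : |δ| ≤ 1) :
    |Ai (s + δ) - Ai s| ≤ |δ| * (6 * gaussianMoment 1 * Real.exp (-s)) := by
  have h := norm_airyLine_add_sub_le s hδ
  rw [airyLine_eq, airyLine_eq, ← Complex.ofReal_sub, Complex.norm_real, Real.norm_eq_abs,
    ← mul_sub, abs_mul, abs_of_pos (by positivity : (0 : ℝ) < 2 * π)] at h
  nlinarith [abs_nonneg (Ai (s + δ) - Ai s), Real.pi_gt_three]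

theorem continuous_Ai : Continuous Ai := by
  refine continuous_iff_continuousAt.2 fun s => ?_
  have h1 : Tendsto (fun y => |y - s| * (6 * gaussianMoment 1 * Real.exp (-s))) (nhds s)
      (nhds 0) := by
    have : Continuous fun y => |y - s| * (6 * gaussianMoment 1 * Real.exp (-s)) := by fun_prop
    simpa using this.tendsto s
  refine tendsto_iff_norm_sub_tendsto_zero.2 (squeeze_zero' (Eventually.of_forall fun y =>
    norm_nonneg _) ?_ h1)
  filter_upwards [Metric.ball_mem_nhds s one_pos] with y hy
  have hd : |y - s| ≤ 1 := by
    have h : |y - s| < 1 := by simpa [Real.dist_eq] using hy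
    exact h.le
  have := abs_Ai_add_sub_le s hd
  rwa [add_sub_cancel] at this

theorem continuous_edgeSum (n : ℕ) (h r : ℝ) : Continuous (edgeSum n h r) := by
  unfold edgeSum
  have h1 := continuous_osc n
  have h2 := continuous_osc (n + 1)
  fun_prop

theorem continuous_edgeDiff (n : ℕ) (h r : ℝ) : Continuous (edgeDiff n h r) := by
  unfold edgeDiff
  have h1 := continuous_osc n
  have h2 := continuous_osc (n + 1)
  fun_prop

/-- The edge estimates for the shifted, scaled wave functions, with a common constant. -/
theorem exists_edge_bounds (s₀ : ℝ) : ∃ C ≥ 0, ∀ (n : ℕ) (h r δ : ℝ), 0 < h → h ≤ 1 / 2 →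
    ((n + 1 : ℕ) : ℝ) * h ^ 3 = 1 → 0 < r → 2 * r ^ 2 = (n + 1 : ℕ) → |δ| ≤ h ^ 2 → ∀ s ≥ s₀,
      |edgeSum n h r (s + δ) - Ai s| ≤ C * h ^ 2 * Real.exp (-(s / 8)) ∧
      |edgeDiff n h r (s + δ)| ≤ C * h * Real.exp (-(s / 8)) ∧
      |Ai s| ≤ C * Real.exp (-(s / 8)) := by
  set S := |s₀| + 1 with hS
  have hS0 : 0 ≤ S := by positivity
  obtain ⟨C₁, hC₁, H₁⟩ := exists_norm_sub_Ai_le S hS0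
  obtain ⟨C₂, hC₂, H₂⟩ := exists_norm_diff_le S hS0
  set M := gaussianMoment 0
  set M₁ := gaussianMoment 1
  have hM : 0 ≤ M := gaussianMoment_nonneg 0
  have hM₁ : 0 ≤ M₁ := gaussianMoment_nonneg 1
  set B := Real.exp S with hB
  set E := Real.exp 1 with hE
  have hB0 : 0 < B := Real.exp_pos _
  have hE0 : 0 < E := Real.exp_pos _
  refine ⟨C₁ * E + 6 * M₁ * B + C₂ * E + 2 * M * B, by positivity, ?_⟩
  intro n h r δ h0 h1 hN hr0 hr hδ s hs
  have hh1 : h ^ 2 ≤ 1 := by nlinarith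
  have hδ1 : |δ| ≤ 1 := hδ.trans hh1
  have hδ' := abs_le.1 hδ1
  have hs1 : -S ≤ s := by have := neg_abs_le s₀; linarith
  have hs2 : -S ≤ s + δ := by have := neg_abs_le s₀; linarith
  have hK0 := edgeConst_nonneg (N := n + 1) h0 hr0
  have hp1 : 1 / (2 * π) ≤ 1 := by
    rw [div_le_one (by positivity)]; linarith [Real.pi_gt_three]
  have hK1 := (edgeConst_le (N := n + 1) h0 n.succ_ne_zero hr0 hr).trans hp1
  have a1 := H₁ (n + 1) h _ h0 h1 hN hK0 hK1
    (abs_edgeConst_sub_le h0 h1 hN n.succ_ne_zero hr0 hr) (s + δ) hs2 (edgeSum n h r (s + δ))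
    fun c hc => ofReal_edgeSum h0 h1 hN hr0 hr hc _
  have a2 := H₂ (n + 1) h _ h0 h1 hN hK0 hK1 (s + δ) hs2 (edgeDiff n h r (s + δ))
    fun c hc => ofReal_edgeDiff h0 h1 hN hr0 hr hc _
  have a3 := abs_Ai_add_sub_le s hδ1
  have a4 := abs_Ai_le s
  have a5 := exp_neg_mul_le (a := 1) hs1 hS0 (by norm_num) le_rfl
  rw [one_mul] at a5
  have a6 : Real.exp (-((s + δ) / 8)) ≤ E * Real.exp (-(s / 8)) := by
    rw [hE, ← Real.exp_add]; apply Real.exp_le_exp.2; linarith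
  set e := Real.exp (-(s / 8)) with he
  have he0 : 0 < e := Real.exp_pos _
  refine ⟨?_, ?_, ?_⟩
  · calc |edgeSum n h r (s + δ) - Ai s| ≤
          |edgeSum n h r (s + δ) - Ai (s + δ)| + |Ai (s + δ) - Ai s| := abs_sub_le _ _ _
      _ ≤ C₁ * h ^ 2 * (E * e) + h ^ 2 * (6 * M₁ * (B * e)) := by
          refine add_le_add (a1.trans (by gcongr)) (a3.trans (by gcongr))
      _ = (C₁ * E + 6 * M₁ * B) * h ^ 2 * e := by ring
      _ ≤ _ := by
          have : 0 ≤ C₂ * E + 2 * M * B := by positivity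
          exact mul_le_mul_of_nonneg_right (mul_le_mul_of_nonneg_right (by linarith)
            (sq_nonneg h)) he0.le
  · calc _ ≤ C₂ * h * (E * e) := a2.trans (by gcongr)
      _ = (C₂ * E) * h * e := by ring
      _ ≤ _ := by
          have : 0 ≤ C₁ * E + 6 * M₁ * B + 2 * M * B := by positivity
          exact mul_le_mul_of_nonneg_right (mul_le_mul_of_nonneg_right (by linarith) h0.le) he0.le
  · calc _ ≤ 2 * M * (B * e) := a4.trans (by gcongr)
      _ = (2 * M * B) * e := by ring
      _ ≤ _ := by
          have : 0 ≤ C₁ * E + 6 * M₁ * B + C₂ * E := by positivity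
          exact mul_le_mul_of_nonneg_right (by linarith) he0.le

theorem integral_Ioi_exp_neg_quarter (a : ℝ) :
    ∫ z in Set.Ioi a, Real.exp (-(z / 4)) = 4 * Real.exp (-(a / 4)) := by
  have := integral_exp_mul_Ioi (a := -(1 / 4)) (by norm_num) a
  calc _ = ∫ z in Set.Ioi a, Real.exp (-(1 / 4) * z) := by congr 1; funext z; ring_nf
    _ = _ := by rw [this]; ring_nf

theorem integrableOn_Ioi_exp_neg_quarter (a : ℝ) :
    IntegrableOn (fun z => Real.exp (-(z / 4))) (Set.Ioi a) := by
  have := integrableOn_exp_mul_Ioi (a := -(1 / 4)) (by norm_num) a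
  exact this.congr_fun (fun z _ => by ring_nf) measurableSet_Ioi

theorem mul_SN2_eq_integral_edge {n : ℕ} {h r : ℝ} (h0 : 0 < h) (hr0 : 0 < r)
    (hr : 2 * r ^ 2 = (n + 1 : ℕ)) (p q : ℝ)
    (hi : IntegrableOn (fun z => edgeSum n h r (p + z) * edgeSum n h r (q + z) -
      edgeDiff n h r (p + z) * edgeDiff n h r (q + z)) (Set.Ioi 0)) :
    1 / (2 * r * h) * SN2 (n + 1) (2 * r + p / (2 * r * h)) (2 * r + q / (2 * r * h)) =
      ∫ z in Set.Ioi (0 : ℝ), (edgeSum n h r (p + z) * edgeSum n h r (q + z) -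
        edgeDiff n h r (p + z) * edgeDiff n h r (q + z)) := by
  set τ := 1 / (2 * r * h) with hτ
  have hτ0 : 0 < τ := by positivity
  have hs : Real.sqrt (2 * (n + 1)) = 2 * r := by
    rw [show 2 * ((n : ℝ) + 1) = (2 * r) ^ 2 by push_cast at hr; linarith]
    exact Real.sqrt_sq (by positivity)
  have hβ : (1 / (h * Real.sqrt (2 * r))) ^ 2 = 2 * (τ * (τ * (2 * r / 2))) := by
    rw [div_pow, mul_pow, Real.sq_sqrt (by positivity), hτ]
    field_simp
  have hpt : ∀ u z : ℝ, 2 * r + (u + z) / (2 * r * h) = 2 * r + u / (2 * r * h) + τ * z := by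
    intro u z; rw [hτ]; ring
  have e : ∀ z, edgeSum n h r (p + z) * edgeSum n h r (q + z) -
      edgeDiff n h r (p + z) * edgeDiff n h r (q + z) = τ * (τ * (Real.sqrt (2 * (n + 1)) / 2 *
        (osc (n + 1) (2 * r + p / (2 * r * h) + τ * z) * osc n (2 * r + q / (2 * r * h) + τ * z) +
        osc n (2 * r + p / (2 * r * h) + τ * z) *
          osc (n + 1) (2 * r + q / (2 * r * h) + τ * z)))) := by
    intro z
    simp only [edgeSum, edgeDiff, hpt]
    rw [hs]
    generalize osc (n + 1) (2 * r + p / (2 * r * h) + τ * z) = P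
    generalize osc (n + 1) (2 * r + q / (2 * r * h) + τ * z) = P'
    generalize osc n (2 * r + p / (2 * r * h) + τ * z) = Q
    generalize osc n (2 * r + q / (2 * r * h) + τ * z) = Q'
    linear_combination (P * Q' + Q * P') / 2 * hβ
  simp only [e] at hi ⊢
  rw [integral_const_mul, ← mul_SN2_eq_integral n hτ0]
  refine IntegrableOn.congr_fun (hi.const_mul τ⁻¹) (fun z _ => ?_) measurableSet_Ioi
  change τ⁻¹ * (τ * _) = _
  rw [inv_mul_cancel_left₀ hτ0.ne']

/-- Pointwise edge asymptotics of the kernel. -/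
theorem abs_kernel_sub_SAiry_le {n : ℕ} {h r δ C s₀ : ℝ} (hC : 0 ≤ C) (h0 : 0 < h) (h1 : h ≤ 1 / 2)
    (hr0 : 0 < r) (hr : 2 * r ^ 2 = (n + 1 : ℕ))
    (H : ∀ s ≥ s₀, |edgeSum n h r (s + δ) - Ai s| ≤ C * h ^ 2 * Real.exp (-(s / 8)) ∧
      |edgeDiff n h r (s + δ)| ≤ C * h * Real.exp (-(s / 8)) ∧ |Ai s| ≤ C * Real.exp (-(s / 8)))
    {s t : ℝ} (hs : s₀ ≤ s) (ht : s₀ ≤ t) :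
    |1 / (2 * r * h) * SN2 (n + 1) (2 * r + (s + δ) / (2 * r * h)) (2 * r + (t + δ) / (2 * r * h)) -
      SAiry s t| ≤ 16 * C ^ 2 * h ^ 2 * (Real.exp (-(s / 8)) * Real.exp (-(t / 8))) := by
  have hh1 : h ^ 2 ≤ 1 := by nlinarith
  have cS := continuous_edgeSum n h r
  have cD := continuous_edgeDiff n h r
  have cA := continuous_Ai
  have hpt : ∀ z ∈ Set.Ioi (0 : ℝ), |edgeSum n h r (s + δ + z) * edgeSum n h r (t + δ + z) -
      edgeDiff n h r (s + δ + z) * edgeDiff n h r (t + δ + z) - Ai (s + z) * Ai (t + z)| ≤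
      4 * C ^ 2 * h ^ 2 * (Real.exp (-(s / 8)) * Real.exp (-(t / 8))) * Real.exp (-(z / 4)) ∧
      |Ai (s + z) * Ai (t + z)| ≤
      C ^ 2 * (Real.exp (-(s / 8)) * Real.exp (-(t / 8))) * Real.exp (-(z / 4)) := by
    intro z hz
    have hz0 : 0 < z := hz
    obtain ⟨p1, p2, p3⟩ := H (s + z) (by linarith)
    obtain ⟨q1, q2, q3⟩ := H (t + z) (by linarith)
    have ee : Real.exp (-(s / 8)) * Real.exp (-(t / 8)) * Real.exp (-(z / 4)) =
        Real.exp (-((s + z) / 8)) * Real.exp (-((t + z) / 8)) := by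
      rw [← Real.exp_add, ← Real.exp_add, ← Real.exp_add]; ring_nf
    rw [mul_assoc, mul_assoc (C ^ 2), ee]
    rw [show s + z + δ = s + δ + z by ring] at p1 p2
    rw [show t + z + δ = t + δ + z by ring] at q1 q2
    generalize edgeSum n h r (s + δ + z) = A at *
    generalize edgeSum n h r (t + δ + z) = A' at *
    generalize edgeDiff n h r (s + δ + z) = B at *
    generalize edgeDiff n h r (t + δ + z) = B' at *
    generalize Ai (s + z) = a at *
    generalize Ai (t + z) = a' at *
    have he := Real.exp_pos (-((s + z) / 8))
    have he' := Real.exp_pos (-((t + z) / 8))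
    generalize Real.exp (-((s + z) / 8)) = e at *
    generalize Real.exp (-((t + z) / 8)) = e' at *
    have hA' : |A'| ≤ 2 * C * e' := by
      have h2 : |A'| ≤ |A' - a'| + |a'| := by
        have := abs_add_le (A' - a') a'; rwa [sub_add_cancel] at this
      have h3 : C * h ^ 2 * e' ≤ C * 1 * e' := by gcongr
      linarith
    refine ⟨?_, ?_⟩
    · calc |A * A' - B * B' - a * a'| = |(A - a) * A' + a * (A' - a') + -(B * B')| := by ring_nf
        _ ≤ |A - a| * |A'| + |a| * |A' - a'| + |B| * |B'| := by
            refine (abs_add_three _ _ _).trans (le_of_eq ?_)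
            rw [abs_neg, abs_mul, abs_mul, abs_mul]
        _ ≤ (C * h ^ 2 * e) * (2 * C * e') + (C * e) * (C * h ^ 2 * e') +
            (C * h * e) * (C * h * e') := by gcongr
        _ = _ := by ring
    · rw [abs_mul]
      calc _ ≤ (C * e) * (C * e') := by gcongr
        _ = _ := by ring
  have hg := integrableOn_Ioi_exp_neg_quarter 0
  have iA : IntegrableOn (fun z => Ai (s + z) * Ai (t + z)) (Set.Ioi 0) := by
    refine Integrable.mono' (hg.const_mul (C ^ 2 * (Real.exp (-(s / 8)) * Real.exp (-(t / 8)))))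
      (Continuous.aestronglyMeasurable (by fun_prop)) ?_
    filter_upwards [ae_restrict_mem measurableSet_Ioi] with z hz
    exact (hpt z hz).2
  have iD : IntegrableOn (fun z => edgeSum n h r (s + δ + z) * edgeSum n h r (t + δ + z) -
      edgeDiff n h r (s + δ + z) * edgeDiff n h r (t + δ + z) - Ai (s + z) * Ai (t + z))
      (Set.Ioi 0) := by
    refine Integrable.mono' (hg.const_mul
      (4 * C ^ 2 * h ^ 2 * (Real.exp (-(s / 8)) * Real.exp (-(t / 8)))))
      (Continuous.aestronglyMeasurable (by fun_prop)) ?_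
    filter_upwards [ae_restrict_mem measurableSet_Ioi] with z hz
    exact (hpt z hz).1
  have iE : IntegrableOn (fun z => edgeSum n h r (s + δ + z) * edgeSum n h r (t + δ + z) -
      edgeDiff n h r (s + δ + z) * edgeDiff n h r (t + δ + z)) (Set.Ioi 0) :=
    (iD.add iA).congr_fun (fun z _ => by simp) measurableSet_Ioi
  rw [mul_SN2_eq_integral_edge h0 hr0 hr _ _ iE, SAiry, ← integral_sub iE iA, ← Real.norm_eq_abs]
  refine (norm_integral_le_of_norm_le (hg.const_mul
    (4 * C ^ 2 * h ^ 2 * (Real.exp (-(s / 8)) * Real.exp (-(t / 8))))) ?_).trans (le_of_eq ?_)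
  · filter_upwards [ae_restrict_mem measurableSet_Ioi] with z hz
    exact (hpt z hz).1
  · rw [integral_const_mul, integral_Ioi_exp_neg_quarter]
    simp; ring

theorem sqrt_integral_integral_sq_le {f : ℝ → ℝ → ℝ} {s₀ D : ℝ} (hD : 0 ≤ D)
    (hf : ∀ s > s₀, ∀ t > s₀, |f s t| ≤ D * (Real.exp (-(s / 8)) * Real.exp (-(t / 8)))) :
    Real.sqrt (∫ s in Set.Ioi s₀, ∫ t in Set.Ioi s₀, f s t ^ 2) ≤
      4 * D * Real.exp (-(s₀ / 4)) := by
  have hg := integrableOn_Ioi_exp_neg_quarter s₀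
  have h1 : ∀ s > s₀, ∫ t in Set.Ioi s₀, f s t ^ 2 ≤
      D ^ 2 * (4 * Real.exp (-(s₀ / 4))) * Real.exp (-(s / 4)) := by
    intro s hs
    calc _ ≤ ∫ t in Set.Ioi s₀, (D ^ 2 * Real.exp (-(s / 4))) * Real.exp (-(t / 4)) := by
          refine integral_mono_of_nonneg (Eventually.of_forall fun t => sq_nonneg _)
            (hg.const_mul _) ?_
          filter_upwards [ae_restrict_mem measurableSet_Ioi] with t ht
          have := pow_le_pow_left₀ (abs_nonneg _) (hf s hs t ht) 2
          rw [sq_abs] at this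
          refine this.trans (le_of_eq ?_)
          rw [mul_pow, mul_pow, ← Real.exp_nat_mul, ← Real.exp_nat_mul, mul_assoc]
          ring_nf
      _ = _ := by rw [integral_const_mul, integral_Ioi_exp_neg_quarter]; ring
  have h2 : ∫ s in Set.Ioi s₀, ∫ t in Set.Ioi s₀, f s t ^ 2 ≤
      (4 * D * Real.exp (-(s₀ / 4))) ^ 2 := by
    calc _ ≤ ∫ s in Set.Ioi s₀, D ^ 2 * (4 * Real.exp (-(s₀ / 4))) * Real.exp (-(s / 4)) := by
          refine integral_mono_of_nonneg (Eventually.of_forall fun s =>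
            integral_nonneg fun t => sq_nonneg _) (hg.const_mul _) ?_
          filter_upwards [ae_restrict_mem measurableSet_Ioi] with s hs
          exact h1 s hs
      _ = _ := by rw [integral_const_mul, integral_Ioi_exp_neg_quarter]; ring
  exact (Real.sqrt_le_sqrt h2).trans (Real.sqrt_sq (by positivity)).le

theorem abs_muU_sub_le {N : ℕ} (hN : 1 ≤ N) {r : ℝ} (hr0 : 0 < r) (hr : 2 * r ^ 2 = N) :
    |muU N - 2 * r| * (2 * r) ≤ 1 / (4 * N) := by
  have hN1 : (1 : ℝ) ≤ N := by exact_mod_cast hN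
  set a := Real.sqrt (2 * N + 1) with ha
  set b := Real.sqrt (2 * N - 1) with hb
  have ha0 : 0 ≤ a := Real.sqrt_nonneg _
  have hb0 : 0 ≤ b := Real.sqrt_nonneg _
  have ha2 : a ^ 2 = 2 * N + 1 := Real.sq_sqrt (by linarith)
  have hb2 : b ^ 2 = 2 * N - 1 := Real.sq_sqrt (by linarith)
  have hmu : muU N = (a + b) / 2 := rfl
  have hab2 : (a * b) ^ 2 = 4 * (N : ℝ) ^ 2 - 1 := by rw [mul_pow, ha2, hb2]; ring
  have hab1 : a * b ≤ 2 * N := by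
    refine abs_le_of_sq_le_sq' ?_ (by positivity) |>.2
    rw [hab2]; nlinarith
  have hinv : 1 / (2 * (N : ℝ)) ≤ 1 := by rw [div_le_one (by positivity)]; linarith
  have hinv0 : 0 < 1 / (2 * (N : ℝ)) := by positivity
  have hab3 : 2 * N - 1 / (2 * (N : ℝ)) ≤ a * b := by
    refine abs_le_of_sq_le_sq' ?_ (by positivity) |>.2
    have e : (2 * N - 1 / (2 * (N : ℝ))) ^ 2 = 4 * (N : ℝ) ^ 2 - 2 + (1 / (2 * (N : ℝ))) ^ 2 := by
      field_simp; ring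
    rw [hab2, e]; nlinarith
  have hsq : muU N ^ 2 = N + a * b / 2 := by rw [hmu]; linear_combination (ha2 + hb2) / 4
  have hprod : |muU N - 2 * r| * (muU N + 2 * r) ≤ 1 / (4 * N) := by
    have hp : 0 ≤ muU N + 2 * r := by rw [hmu]; positivity
    rw [← abs_of_nonneg hp, ← abs_mul,
      show (muU N - 2 * r) * (muU N + 2 * r) = a * b / 2 - N by
        linear_combination hsq - 2 * hr]
    have e : 1 / (4 * (N : ℝ)) = 1 / (2 * (N : ℝ)) / 2 := by field_simp; norm_num
    rw [e, abs_le]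
    constructor <;> linarith
  have hmu0 : 0 ≤ muU N := by rw [hmu]; positivity
  refine le_trans ?_ hprod
  gcongr
  linarith

end KernelEstimate

/-- L² (Hilbert–Schmidt) convergence of the rescaled GUE kernel to the Airy kernel
at rate `N^{-2/3}`. -/
theorem gue_kernel_airy_kernel_hs_bound (s₀ : ℝ) :
    ∃ C > 0, ∃ N₀ : ℕ, ∀ N : ℕ, N₀ ≤ N →
      Real.sqrt (∫ s in Set.Ioi s₀, ∫ t in Set.Ioi s₀,
          (tauN N * SN2 N (muU N + tauN N * s) (muU N + tauN N * t) - SAiry s t) ^ 2) ≤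
        C * (N : ℝ) ^ (-(2 : ℝ) / 3) * Real.exp (-s₀) := by
  obtain ⟨C, hC, H⟩ := exists_edge_bounds s₀
  refine ⟨64 * C ^ 2 * Real.exp (3 / 4 * s₀) + 1, by positivity, 8, fun N hN8 => ?_⟩
  obtain ⟨n, rfl⟩ : ∃ n, N = n + 1 := ⟨N - 1, by omega⟩
  set N := n + 1 with hNdef
  have hN1 : 1 ≤ N := by omega
  have hN8' : (8 : ℝ) ≤ N := by exact_mod_cast hN8
  have hN0 : (0 : ℝ) < N := by linarith
  set h : ℝ := (N : ℝ) ^ (-(1 : ℝ) / 3) with hh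
  set r : ℝ := Real.sqrt (N / 2) with hr
  have h0 : 0 < h := Real.rpow_pos_of_pos hN0 _
  have hr0 : 0 < r := Real.sqrt_pos.2 (by positivity)
  have hr2 : 2 * r ^ 2 = N := by rw [hr, Real.sq_sqrt (by positivity)]; ring
  have hh3 : (N : ℝ) * h ^ 3 = 1 := by
    rw [hh, ← Real.rpow_natCast, ← Real.rpow_mul hN0.le]
    norm_num
    rw [Real.rpow_neg_one]
    exact mul_inv_cancel₀ hN0.ne'
  have hh2 : (N : ℝ) ^ (-(2 : ℝ) / 3) = h ^ 2 := by
    rw [hh, ← Real.rpow_natCast, ← Real.rpow_mul hN0.le]; norm_num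
  have h1 : h ≤ 1 / 2 := by
    by_contra! hlt
    have : (1 / 2 : ℝ) ^ 3 < h ^ 3 := pow_lt_pow_left₀ hlt (by norm_num) (by norm_num)
    nlinarith
  have hτ : tauN N = 1 / (2 * r * h) := by
    have e : tauN N ^ 2 = (1 / (2 * r * h)) ^ 2 := by
      rw [tauN, mul_pow, ← Real.rpow_natCast, ← Real.rpow_natCast, ← Real.rpow_mul hN0.le,
        ← Real.rpow_mul zero_le_two]
      have e1 : (2 : ℝ) ^ (-(1 : ℝ) / 2 * (2 : ℕ)) = 1 / 2 := by norm_num [Real.rpow_neg_one]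
      have e2 : (N : ℝ) ^ (-(1 : ℝ) / 6 * (2 : ℕ)) = h := by rw [hh]; norm_num
      rw [e1, e2, div_pow, mul_pow, mul_pow]
      rw [eq_div_iff (by positivity)]
      linear_combination hh3 + h ^ 3 * hr2
    have hτ0 : 0 ≤ tauN N := by unfold tauN; positivity
    exact (sq_eq_sq₀ hτ0 (by positivity)).1 e
  set δ : ℝ := (muU N - 2 * r) * (2 * r * h) with hδ
  have hδ1 : |δ| ≤ h ^ 2 := by
    have hmu := abs_muU_sub_le hN1 hr0 hr2
    have e : 1 / (4 * (N : ℝ)) = h ^ 3 / 4 := by field_simp; linarith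
    rw [e] at hmu
    have h4 : h ^ 4 ≤ h ^ 2 := pow_le_pow_of_le_one h0.le (by linarith) (by norm_num)
    rw [hδ, abs_mul, abs_of_pos (by positivity : 0 < 2 * r * h)]
    calc _ = (|muU N - 2 * r| * (2 * r)) * h := by ring
      _ ≤ h ^ 3 / 4 * h := by gcongr
      _ ≤ h ^ 2 := by nlinarith [pow_pos h0 4]
  have hpt : ∀ s : ℝ, muU N + tauN N * s = 2 * r + (s + δ) / (2 * r * h) := by
    intro s; rw [hτ, hδ]; field_simp; ring
  have key := sqrt_integral_integral_sq_le (s₀ := s₀) (D := 16 * C ^ 2 * h ^ 2)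
    (f := fun s t => tauN N * SN2 N (muU N + tauN N * s) (muU N + tauN N * t) - SAiry s t)
    (by positivity) fun s hs t ht => by
      rw [hpt, hpt, hτ]
      exact abs_kernel_sub_SAiry_le hC h0 h1 hr0 hr2
        (H n h r δ h0 h1 hh3 hr0 hr2 hδ1) (le_of_lt hs) (le_of_lt ht)
  refine key.trans ?_
  rw [hh2]
  have e : Real.exp (-(s₀ / 4)) = Real.exp (3 / 4 * s₀) * Real.exp (-s₀) := by
    rw [← Real.exp_add]; ring_nf
  rw [e]
  have : 0 < h ^ 2 * Real.exp (-s₀) := by positivity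
  calc _ = 64 * C ^ 2 * Real.exp (3 / 4 * s₀) * (h ^ 2 * Real.exp (-s₀)) := by ring
    _ ≤ (64 * C ^ 2 * Real.exp (3 / 4 * s₀) + 1) * (h ^ 2 * Real.exp (-s₀)) := by
        gcongr; linarith
    _ = _ := by ring
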